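/- Let p_R = B/(4R^α) (with the truncation convention) for some B > 0 and 0 < α < 1. Then: (i) with probability 1 there exist infinitely many R such that ξ(R+j,∞) = 1 for every j = 0,1,…,⌊g*(R)⌋; (ii) for every ε > 0, with probability 1, for all sufficiently large R there exists an integer S with R ≤ S ≤ R + f*(R,ε) such that ξ(S,∞) > 1. -/

import Mathlib

open MeasureTheory Filter Finset
open scoped ENNReal NNReal Topology

noncomputable section

namespace NNRW

/-- Probability of a step to the right from site `i`: `E 0 = 1`, `E i = 1/2 + p i` for `i ≥ 1`. -/
def E (p : ℕ → ℝ) (i : ℕ) : ℝ := if i = 0 then 1 else 1 / 2 + p i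

/-- One-step transition probability of the nearest-neighbour walk, from `i` to `j`. -/
def step (p : ℕ → ℝ) (i j : ℕ) : ℝ :=
  if j = i + 1 then E p i else if j + 1 = i then 1 - E p i else 0

/-- `X` is (distributed as) the nearest-neighbour Markov chain with parameters `p`, started
at `b`, under the probability measure `P`: `X 0 = b` and the finite-dimensional
distributions are the products of the one-step transition probabilities. -/
def IsNNWalk {Ω : Type*} [MeasurableSpace Ω] (P : Measure Ω)
    (X : ℕ → Ω → ℕ) (p : ℕ → ℝ) (b : ℕ) : Prop :=
  (∀ ω, X 0 ω = b) ∧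
    ∀ (n : ℕ) (u : ℕ → ℕ), u 0 = b →
      P {ω | ∀ k ≤ n, X k ω = u k} =
        ENNReal.ofReal (∏ k ∈ Finset.range n, step p (u k) (u (k + 1)))

/-- `U i = (1/2 - p i)/(1/2 + p i)`. -/
def U (p : ℕ → ℝ) (i : ℕ) : ℝ := (1 / 2 - p i) / (1 / 2 + p i)

/-- `D(m,n)` for finite `m ≤ n`. -/
def Dfin (p : ℕ → ℝ) (m n : ℕ) : ℝ :=
  if n = m then 0
  else 1 + ∑ j ∈ Finset.Icc 1 (n - m - 1), ∏ i ∈ Finset.Icc 1 j, U p (m + i)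

/-- `D(m,∞) = lim_{n → ∞} D(m,n) ∈ (0,∞]`. -/
def Dinf (p : ℕ → ℝ) (m : ℕ) : ℝ≥0∞ :=
  1 + ∑' j : ℕ, ENNReal.ofReal (∏ i ∈ Finset.Icc 1 (j + 1), U p (m + i))

/-- Event: the walk visits `a` (strictly) before it ever visits `c`. -/
def hitsBefore {Ω : Type*} (X : ℕ → Ω → ℕ) (a c : ℕ) : Set Ω :=
  {ω | ∃ n, X n ω = a ∧ ∀ k < n, X k ω ≠ c}

/-- Event: the walk ever visits `a`. -/
def hits {Ω : Type*} (X : ℕ → Ω → ℕ) (a : ℕ) : Set Ω := {ω | ∃ n, X n ω = a}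

/-- Total local time `ξ(x,∞)` at site `x` (equal to `∞` if there are infinitely many
visits). -/
def localTime {Ω : Type*} (X : ℕ → Ω → ℕ) (x : ℕ) (ω : Ω) : ℝ≥0∞ :=
  ∑' k : ℕ, Set.indicator {k | X k ω = x} (fun _ => (1 : ℝ≥0∞)) k

/-- Total number of upcrossings `ξ(x,∞,↑)` at site `x`. -/
def upcross {Ω : Type*} (X : ℕ → Ω → ℕ) (x : ℕ) (ω : Ω) : ℝ≥0∞ :=
  ∑' k : ℕ, Set.indicator {k | X k ω = x ∧ X (k + 1) ω = x + 1} (fun _ => (1 : ℝ≥0∞)) k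

/-- Iterated logarithm: `iterLog 0 x = x`, `iterLog (k+1) x = log (iterLog k x)`. -/
def iterLog : ℕ → ℝ → ℝ
  | 0, x => x
  | k + 1, x => Real.log (iterLog k x)

/-- `λ(k,x)`: `lam 0 x = 1`, `lam (k+1) x = lam k x * log_k x`. -/
def lam : ℕ → ℝ → ℝ
  | 0, _ => 1
  | k + 1, x => lam k x * iterLog k x

/-- `Λ(K,x,B) = Λ(K-1,x) + B/λ(K,x)` where `Λ(K,x) = ∑_{k=1}^{K} 1/λ(k,x)`. -/
def LamB (K : ℕ) (B : ℝ) (x : ℝ) : ℝ :=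
  (∑ k ∈ Finset.Icc 1 (K - 1), 1 / lam k x) + B / lam K x

/-- The truncation convention: with `i₀ = min{i ≥ 1 : q i < 1/2}` one has `p i = q i₀`
for `1 ≤ i ≤ i₀` and `p i = q i` for `i > i₀`. -/
def IsTruncation (q p : ℕ → ℝ) : Prop :=
  ∃ i0 : ℕ, 1 ≤ i0 ∧ q i0 < 1 / 2 ∧ (∀ i, 1 ≤ i → i < i0 → ¬ q i < 1 / 2) ∧
    (∀ i, 1 ≤ i → i ≤ i0 → p i = q i0) ∧ ∀ i, i0 < i → p i = q i

end NNRW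

open NNRW
/-- `f*(R,ε) = (1+ε)(1-α) log R / log 2`; `g*(R) = f*(R,0)`. -/
def fStar (α : ℝ) (R : ℕ) (ε : ℝ) : ℝ :=
  (1 + ε) * (1 - α) * Real.log (R : ℝ) / Real.log 2

namespace NNRW

lemma E_nonneg {p : ℕ → ℝ} (hp : ∀ i, 1 ≤ i → 0 ≤ p i ∧ p i < 1 / 2) (i : ℕ) : 0 ≤ E p i := by
  unfold E
  split_ifs with h
  · norm_num
  · linarith [(hp i (by omega)).1]

lemma E_le_one {p : ℕ → ℝ} (hp : ∀ i, 1 ≤ i → 0 ≤ p i ∧ p i < 1 / 2) (i : ℕ) : E p i ≤ 1 := by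
  unfold E
  split_ifs with h
  · norm_num
  · linarith [(hp i (by omega)).2]

lemma half_le_E {p : ℕ → ℝ} (hp : ∀ i, 1 ≤ i → 0 ≤ p i ∧ p i < 1 / 2) (i : ℕ) :
    1 / 2 ≤ E p i := by
  unfold E
  split_ifs with h
  · norm_num
  · linarith [(hp i (by omega)).1]

lemma E_zero (p : ℕ → ℝ) : E p 0 = 1 := by simp [E]

lemma step_nonneg {p : ℕ → ℝ} (hp : ∀ i, 1 ≤ i → 0 ≤ p i ∧ p i < 1 / 2) (i j : ℕ) :
    0 ≤ step p i j := by
  unfold step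
  split_ifs
  · exact E_nonneg hp i
  · linarith [E_le_one hp i]
  · exact le_rfl

/-- Averages against the one-step kernel: only the two neighbours contribute. -/
lemma tsum_step {p : ℕ → ℝ} (i : ℕ) (f : ℕ → ℝ≥0∞) :
    ∑' j, ENNReal.ofReal (step p i j) * f j =
      ENNReal.ofReal (E p i) * f (i + 1) + ENNReal.ofReal (1 - E p i) * f (i - 1) := by
  rcases Nat.eq_zero_or_pos i with rfl | hi
  · rw [tsum_eq_single 1]
    · simp [step, E_zero]
    · intro j hj
      simp [step, hj]
  · rw [tsum_eq_sum (s := {i + 1, i - 1})]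
    · rw [Finset.sum_pair (by omega)]
      have h1 : i - 1 ≠ i + 1 := by omega
      have h2 : i - 1 + 1 = i := by omega
      simp [step, h1, h2]
    · intro j hj
      simp only [Finset.mem_insert, Finset.mem_singleton, not_or] at hj
      have h2 : j + 1 ≠ i := by omega
      simp [step, hj.1, h2]

lemma tsum_step_eq_one {p : ℕ → ℝ} (hp : ∀ i, 1 ≤ i → 0 ≤ p i ∧ p i < 1 / 2) (i : ℕ) :
    ∑' j, ENNReal.ofReal (step p i j) = 1 := by
  have := tsum_step (p := p) i (fun _ => 1)
  simp only [mul_one] at this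
  rw [this, ← ENNReal.ofReal_add (E_nonneg hp i) (by linarith [E_le_one hp i])]
  simp

/-- A subset of a null-measurable set which splits its measure additively is null-measurable. -/
lemma nullMeasurableSet_of_add_sdiff_le {Ω : Type*} [MeasurableSpace Ω] {P : Measure Ω}
    [IsFiniteMeasure P] {A B : Set Ω} (hA : NullMeasurableSet A P) (h : P B + P (A \ B) ≤ P A) :
    NullMeasurableSet B P := by
  set N := toMeasurable P (A \ B)
  have hN : MeasurableSet N := measurableSet_toMeasurable _ _
  have hPN : P N = P (A \ B) := measure_toMeasurable _
  have hsub : A \ N ⊆ B := by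
    intro ω hω
    by_contra hB
    exact hω.2 (subset_toMeasurable P (A \ B) ⟨hω.1, hB⟩)
  have hAN : NullMeasurableSet (A \ N) P := hA.diff hN.nullMeasurableSet
  have hle : P B ≤ P (A \ N) := by
    have h1 : P A ≤ P (A \ N) + P N := by
      calc P A ≤ P ((A \ N) ∪ N) := measure_mono (by intro x hx; by_cases hxN : x ∈ N <;> simp [*])
        _ ≤ _ := measure_union_le _ _
    rw [← hPN] at h
    exact (ENNReal.add_le_add_iff_right (measure_ne_top P N)).1 (h.trans h1)
  exact hAN.congr (ae_eq_of_subset_of_measure_ge hsub hle hAN (measure_ne_top P B))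

/-- An event about the `n`-th coordinate is a countable union of cylinders. -/
lemma setOf_coord_mem_eq_iUnion {Ω : Type*} (f : Ω → ℕ → ℕ) (n : ℕ) (s : Set ℕ) :
    {ω | f ω n ∈ s} = ⋃ (l : List ℕ) (_ : l.getD n 0 ∈ s), {ω | ∀ k ≤ n, f ω k = l.getD k 0} := by
  ext ω
  simp only [Set.mem_iUnion]
  constructor
  · intro h
    have hk : ∀ k ≤ n, ((List.range (n + 1)).map (f ω)).getD k 0 = f ω k := by
      intro k hk
      rw [List.getD_eq_getElem _ _ (by simp; omega)]
      simp
    exact ⟨(List.range (n + 1)).map (f ω), by rw [hk n le_rfl]; exact h,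
      fun k hk' => (hk k hk').symm⟩
  · rintro ⟨l, hl, h⟩
    change f ω n ∈ s
    rw [h n le_rfl]
    exact hl

section Measurability

variable {Ω : Type*} [MeasurableSpace Ω] {P : Measure Ω} [IsProbabilityMeasure P]
  {X : ℕ → Ω → ℕ} {p : ℕ → ℝ}

lemma nullMeasurableSet_cylinder (hp : ∀ i, 1 ≤ i → 0 ≤ p i ∧ p i < 1 / 2)
    (hX : IsNNWalk P X p 0) (n : ℕ) (u : ℕ → ℕ) :
    NullMeasurableSet {ω | ∀ k ≤ n, X k ω = u k} P := by
  by_cases hu : u 0 = 0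
  swap
  · convert nullMeasurableSet_empty (μ := P)
    ext ω
    simp only [Set.mem_ofPred_eq, Set.mem_empty_iff_false, iff_false]
    intro h
    exact hu (by rw [← h 0 (Nat.zero_le _), hX.1])
  induction n with
  | zero =>
    convert nullMeasurableSet_univ (μ := P)
    ext ω
    simp [hX.1, hu]
  | succ n ih =>
    set A := {ω | ∀ k ≤ n, X k ω = u k} with hA
    set v : ℕ → ℕ → ℕ := fun y => Function.update u (n + 1) y with hv
    set C : ℕ → Set Ω := fun y => {ω | ∀ k ≤ n + 1, X k ω = v y k} with hC
    have hCv : ∀ y, P (C y) = P A * ENNReal.ofReal (step p (u n) y) := by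
      intro y
      rw [hC, hA]
      simp only
      have hv0 : v y 0 = 0 := by simp [hv, hu]
      rw [hX.2 (n + 1) (v y) hv0, hX.2 n u hu, Finset.prod_range_succ, ENNReal.ofReal_mul
        (Finset.prod_nonneg fun k _ => step_nonneg hp _ _)]
      congr 2
      · apply Finset.prod_congr rfl
        intro k hk
        rw [Finset.mem_range] at hk
        simp only [hv]
        rw [Function.update_of_ne (by omega), Function.update_of_ne (by omega)]
      · simp [hv]
    have hBC : {ω | ∀ k ≤ n + 1, X k ω = u k} = C (u (n + 1)) := by
      simp [hC, hv]
    rw [hBC]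
    have hsum : ∑' y, P (C y) = P A := by
      simp_rw [hCv]
      rw [ENNReal.tsum_mul_left, tsum_step_eq_one hp, mul_one]
    refine nullMeasurableSet_of_add_sdiff_le ih ?_
    · rw [← hsum, ENNReal.tsum_eq_add_tsum_ite (u (n + 1))]
      gcongr
      calc P (A \ C (u (n + 1))) ≤ P (⋃ y, if y = u (n + 1) then ∅ else C y) := by
            apply measure_mono
            rintro ω ⟨hω, hω'⟩
            rw [Set.mem_iUnion]
            refine ⟨X (n + 1) ω, ?_⟩
            have hmem : ω ∈ C (X (n + 1) ω) := by
              intro k hk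
              rcases Nat.lt_or_ge n k with h | h
              · have : k = n + 1 := by omega
                subst this
                simp [hv]
              · simp only [hv]
                rw [Function.update_of_ne (by omega)]
                exact hω k h
            rw [if_neg]
            · exact hmem
            · intro h
              rw [h] at hmem
              exact hω' hmem
        _ ≤ ∑' y, P (if y = u (n + 1) then ∅ else C y) := measure_iUnion_le _
        _ = _ := by
            congr 1
            ext y
            split_ifs <;> simp

lemma aemeasurable_coord (hp : ∀ i, 1 ≤ i → 0 ≤ p i ∧ p i < 1 / 2)
    (hX : IsNNWalk P X p 0) (n : ℕ) : AEMeasurable (X n) P := by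
  apply NullMeasurable.aemeasurable
  intro s _
  change NullMeasurableSet {ω | X n ω ∈ s} P
  rw [setOf_coord_mem_eq_iUnion (fun ω k => X k ω)]
  exact NullMeasurableSet.iUnion fun l => NullMeasurableSet.iUnion fun _ =>
    nullMeasurableSet_cylinder hp hX n _

end Measurability

/-- The cylinder of paths agreeing with `u` up to time `n`. -/
def cyl (n : ℕ) (u : ℕ → ℕ) : Set (ℕ → ℕ) := {w | ∀ k ≤ n, w k = u k}

lemma measurableSet_cyl (n : ℕ) (u : ℕ → ℕ) : MeasurableSet (cyl n u) := by
  have : cyl n u = ⋂ k, ⋂ (_ : k ≤ n), (fun w : ℕ → ℕ => w k) ⁻¹' {u k} := by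
    ext w; simp [cyl]
  rw [this]
  exact MeasurableSet.iInter fun k => MeasurableSet.iInter fun _ =>
    measurable_pi_apply k (measurableSet_singleton _)

/-- Cylinders determine a finite measure on path space. -/
lemma ext_of_cyl {μ ν : Measure (ℕ → ℕ)} [IsProbabilityMeasure μ] [IsProbabilityMeasure ν]
    (h : ∀ n u, μ (cyl n u) = ν (cyl n u)) : μ = ν := by
  refine ext_of_generate_finite {s | ∃ n u, s = cyl n u} ?_ ?_ ?_ (by simp)
  · apply le_antisymm
    · refine iSup_le fun n => ?_
      rintro t ⟨s, -, rfl⟩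
      change @MeasurableSet _ (MeasurableSpace.generateFrom _) {w : ℕ → ℕ | w n ∈ s}
      rw [setOf_coord_mem_eq_iUnion (fun w : ℕ → ℕ => w)]
      exact MeasurableSet.iUnion fun l => MeasurableSet.iUnion fun _ =>
        MeasurableSpace.measurableSet_generateFrom ⟨n, _, rfl⟩
    · refine MeasurableSpace.generateFrom_le ?_
      rintro s ⟨n, u, rfl⟩
      exact measurableSet_cyl n u
  · rintro s ⟨n, u, rfl⟩ t ⟨m, v, rfl⟩ ⟨w, hw1, hw2⟩
    refine ⟨max n m, w, ?_⟩
    ext w'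
    constructor
    · rintro ⟨h1, h2⟩ k hk
      rcases le_max_iff.1 hk with h | h
      · rw [h1 k h, hw1 k h]
      · rw [h2 k h, hw2 k h]
    · intro h
      exact ⟨fun k hk => by rw [h k (le_max_of_le_left hk), hw1 k hk],
        fun k hk => by rw [h k (le_max_of_le_right hk), hw2 k hk]⟩
  · rintro s ⟨n, u, rfl⟩
    exact h n u

/-- Prepend a starting point to a path. -/
def pathCons (x : ℕ) (w : ℕ → ℕ) : ℕ → ℕ
  | 0 => x
  | k + 1 => w k

@[simp] lemma pathCons_zero (x : ℕ) (w : ℕ → ℕ) : pathCons x w 0 = x := rfl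

@[simp] lemma pathCons_succ (x : ℕ) (w : ℕ → ℕ) (k : ℕ) : pathCons x w (k + 1) = w k := rfl

lemma measurable_pathCons (x : ℕ) : Measurable (pathCons x) := by
  rw [measurable_pi_iff]
  rintro (_ | k)
  · exact measurable_const
  · exact measurable_pi_apply k

/-- A family of path measures satisfying the first-step decomposition of the walk. -/
structure IsPathFamily (p : ℕ → ℝ) (μ : ℕ → Measure (ℕ → ℕ)) : Prop where
  prob : ∀ x, IsProbabilityMeasure (μ x)
  first_step : ∀ x (G : Set (ℕ → ℕ)), MeasurableSet G →
    (μ x).real G = E p x * (μ (x + 1)).real (pathCons x ⁻¹' G) +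
      (1 - E p x) * (μ (x - 1)).real (pathCons x ⁻¹' G)

/-- Path measures with the finite-dimensional distributions of the walk form a path family. -/
lemma isPathFamily_of_cyl {p : ℕ → ℝ} (hp : ∀ i, 1 ≤ i → 0 ≤ p i ∧ p i < 1 / 2)
    {μ : ℕ → Measure (ℕ → ℕ)} (hprob : ∀ x, IsProbabilityMeasure (μ x))
    (hcyl : ∀ x n u, μ x (cyl n u) = if u 0 = x then
      ENNReal.ofReal (∏ k ∈ Finset.range n, step p (u k) (u (k + 1))) else 0) :
    IsPathFamily p μ := by
  refine ⟨hprob, fun x G hG => ?_⟩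
  set ν : Measure (ℕ → ℕ) := ENNReal.ofReal (E p x) • (μ (x + 1)).map (pathCons x) +
    ENNReal.ofReal (1 - E p x) • (μ (x - 1)).map (pathCons x) with hν
  have hνapp : ∀ s, MeasurableSet s → ν s = ENNReal.ofReal (E p x) * μ (x + 1) (pathCons x ⁻¹' s)
      + ENNReal.ofReal (1 - E p x) * μ (x - 1) (pathCons x ⁻¹' s) := by
    intro s hs
    simp [hν, Measure.map_apply (measurable_pathCons x) hs]
  have hone : ENNReal.ofReal (E p x) + ENNReal.ofReal (1 - E p x) = 1 := by
    rw [← ENNReal.ofReal_add (E_nonneg hp x) (by linarith [E_le_one hp x])]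
    simp
  have : IsProbabilityMeasure ν := ⟨by rw [hνapp _ MeasurableSet.univ]; simp [hone]⟩
  have heq : μ x = ν := by
    refine ext_of_cyl fun n u => ?_
    rw [hνapp _ (measurableSet_cyl n u), hcyl]
    split_ifs with hu
    · cases n with
      | zero =>
        have : pathCons x ⁻¹' cyl 0 u = Set.univ := by ext w; simp [cyl, hu]
        simp [this, hone]
      | succ n =>
        have : pathCons x ⁻¹' cyl (n + 1) u = cyl n (fun k => u (k + 1)) := by
          ext w
          constructor
          · intro h k hk
            exact h (k + 1) (by omega)
          · rintro h (_ | k) hk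
            · exact hu.symm
            · exact h k (by omega)
        rw [this, ← tsum_step x (fun j => μ j (cyl n fun k => u (k + 1)))]
        simp_rw [hcyl]
        rw [tsum_eq_single (u 1)]
        · rw [Finset.prod_range_succ', mul_comm, ENNReal.ofReal_mul (step_nonneg hp _ _)]
          simp [hu]
        · intro j hj
          simp [Ne.symm hj]
    · have : pathCons x ⁻¹' cyl n u = ∅ := by
        ext w
        simp only [Set.mem_preimage, Set.mem_empty_iff_false, iff_false]
        intro h
        exact hu (h 0 (Nat.zero_le _)).symm
      simp [this]
  have := hprob (x + 1)
  have := hprob (x - 1)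
  rw [measureReal_def, heq, hνapp G hG, ENNReal.toReal_add (by finiteness) (by finiteness),
    ENNReal.toReal_mul, ENNReal.toReal_mul, ENNReal.toReal_ofReal (E_nonneg hp x),
    ENNReal.toReal_ofReal (by linarith [E_le_one hp x])]
  rfl

/-- The laws of the walk from all starting points, obtained from the law started at the origin
by conditioning on an initial straight ascent. -/
lemma exists_isPathFamily {p : ℕ → ℝ} (hp : ∀ i, 1 ≤ i → 0 ≤ p i ∧ p i < 1 / 2)
    {Ω : Type*} [MeasurableSpace Ω] {P : Measure Ω} [IsProbabilityMeasure P]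
    {X : ℕ → Ω → ℕ} (hX : IsNNWalk P X p 0) :
    ∃ μ : ℕ → Measure (ℕ → ℕ), IsPathFamily p μ ∧ μ 0 = P.map (fun ω n => X n ω) := by
  have hae : AEMeasurable (fun ω n => X n ω) P := aemeasurable_pi_iff.2 (aemeasurable_coord hp hX)
  set Q := P.map (fun ω n => X n ω) with hQ
  have : IsProbabilityMeasure Q := Measure.isProbabilityMeasure_map hae
  have hQcyl : ∀ n u, Q (cyl n u) = if u 0 = 0 then
      ENNReal.ofReal (∏ k ∈ Finset.range n, step p (u k) (u (k + 1))) else 0 := by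
    intro n u
    rw [hQ, Measure.map_apply_of_aemeasurable hae (measurableSet_cyl n u)]
    split_ifs with hu
    · exact hX.2 n u hu
    · convert measure_empty (μ := P)
      ext ω
      simp only [Set.mem_preimage, Set.mem_empty_iff_false, iff_false]
      intro h
      exact hu (by rw [← h 0 (Nat.zero_le _)]; exact hX.1 ω)
  have hpos : ∀ x, 0 < ∏ k ∈ Finset.range x, step p k (k + 1) := fun x =>
    Finset.prod_pos fun k _ => by
      simpa [step] using (by norm_num : (0 : ℝ) < 1 / 2).trans_le (half_le_E hp k)
  have hQid : ∀ x, Q (cyl x id) = ENNReal.ofReal (∏ k ∈ Finset.range x, step p k (k + 1)) := by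
    intro x
    simp [hQcyl]
  have hQne : ∀ x, Q (cyl x id) ≠ 0 := by
    intro x
    rw [hQid]
    simpa using hpos x
  have hshift : ∀ x, Measurable (fun (w : ℕ → ℕ) k => w (x + k)) := fun x =>
    measurable_pi_iff.2 fun k => measurable_pi_apply (x + k)
  refine ⟨fun x => (ProbabilityTheory.cond Q (cyl x id)).map (fun w k => w (x + k)),
    isPathFamily_of_cyl hp (fun x => ?_) (fun x n u => ?_), ?_⟩
  · have := ProbabilityTheory.cond_isProbabilityMeasure (hQne x)
    exact Measure.isProbabilityMeasure_map (hshift x).aemeasurable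
  · rw [Measure.map_apply (hshift x) (measurableSet_cyl n u),
      ProbabilityTheory.cond_apply (measurableSet_cyl x id)]
    split_ifs with hu
    · set v : ℕ → ℕ := fun k => if k ≤ x then k else u (k - x) with hv
      have hvx : ∀ k, v (x + k) = u k := by
        intro k
        simp only [hv]
        split_ifs with h
        · have : k = 0 := by omega
          subst this
          simp [hu]
        · congr 1
          omega
      have : cyl x id ∩ (fun (w : ℕ → ℕ) k => w (x + k)) ⁻¹' cyl n u = cyl (x + n) v := by
        ext w
        constructor
        · rintro ⟨h1, h2⟩ k hk
          rcases le_or_gt k x with h | h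
          · rw [h1 k h]
            simp [hv, h]
          · obtain ⟨j, rfl⟩ := Nat.exists_eq_add_of_le h.le
            rw [hvx]
            exact h2 j (by omega)
        · intro h
          refine ⟨fun k hk => ?_, fun k hk => ?_⟩
          · rw [h k (by omega)]
            simp [hv, hk]
          · change w (x + k) = u k
            rw [h (x + k) (by omega), hvx]
      rw [this, hQid, hQcyl, if_pos (by simp [hv]), Finset.prod_range_add,
        ENNReal.ofReal_mul (Finset.prod_nonneg fun _ _ => step_nonneg hp _ _)]
      have h1 : ∏ k ∈ Finset.range x, step p (v k) (v (k + 1)) =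
          ∏ k ∈ Finset.range x, step p k (k + 1) := by
        apply Finset.prod_congr rfl
        intro k hk
        rw [Finset.mem_range] at hk
        simp [hv, hk.le, Nat.succ_le_of_lt hk]
      have h2 : ∏ k ∈ Finset.range n, step p (v (x + k)) (v (x + k + 1)) =
          ∏ k ∈ Finset.range n, step p (u k) (u (k + 1)) := by
        apply Finset.prod_congr rfl
        intro k _
        rw [hvx, add_assoc, hvx]
      rw [h1, h2, ← mul_assoc, ENNReal.inv_mul_cancel _ ENNReal.ofReal_ne_top, one_mul]
      simpa using hpos x
    · have : cyl x id ∩ (fun (w : ℕ → ℕ) k => w (x + k)) ⁻¹' cyl n u = ∅ := by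
        ext w
        simp only [Set.mem_inter_iff, Set.mem_preimage, Set.mem_empty_iff_false, iff_false]
        rintro ⟨h1, h2⟩
        apply hu
        rw [← h2 0 (Nat.zero_le _)]
        exact h1 x le_rfl
      simp [this]
  · have huniv : ProbabilityTheory.cond Q (cyl 0 id) = Q := by
      have : Q (cyl 0 id) = 1 := by rw [hQid]; simp
      refine Measure.ext fun s hs => ?_
      rw [ProbabilityTheory.cond_apply (measurableSet_cyl 0 id), this, Set.inter_comm,
        measure_inter_conull ((prob_compl_eq_zero_iff (measurableSet_cyl 0 id)).2 this)]
      simp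
    simp only [zero_add]
    rw [huniv]
    exact Measure.map_id

/-- The products `U (m+1) ⋯ U (m+j)`. -/
def oddsProd (p : ℕ → ℝ) (m j : ℕ) : ℝ := ∏ i ∈ Finset.range j, U p (m + 1 + i)

/-- The scale function of the walk above level `m`: it is harmonic off `m`, vanishes at `m`, and
takes the value `1` at `m + 1`. -/
def scale (p : ℕ → ℝ) (m k : ℕ) : ℝ := ∑ j ∈ Finset.range k, oddsProd p m j

/-- Probability of `j` consecutive steps to the right, starting from `R`. -/
def ascentProb (p : ℕ → ℝ) (R j : ℕ) : ℝ := ∏ i ∈ Finset.range j, E p (R + i)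

@[simp] lemma scale_zero (p : ℕ → ℝ) (m : ℕ) : scale p m 0 = 0 := by simp [scale]

@[simp] lemma scale_one (p : ℕ → ℝ) (m : ℕ) : scale p m 1 = 1 := by simp [scale, oddsProd]

lemma scale_succ (p : ℕ → ℝ) (m k : ℕ) : scale p m (k + 1) = scale p m k + oddsProd p m k := by
  simp [scale, Finset.sum_range_succ]

lemma oddsProd_succ (p : ℕ → ℝ) (m k : ℕ) :
    oddsProd p m (k + 1) = oddsProd p m k * U p (m + 1 + k) := by
  simp [oddsProd, Finset.prod_range_succ]

lemma ascentProb_succ' (p : ℕ → ℝ) (R j : ℕ) :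
    ascentProb p R (j + 1) = E p R * ascentProb p (R + 1) j := by
  simp only [ascentProb, Finset.prod_range_succ', add_zero, mul_comm (E p R)]
  congr 1
  exact Finset.prod_congr rfl fun k _ => by rw [add_assoc, add_comm 1 k]

section Recurrences

variable {p : ℕ → ℝ} (hp : ∀ i, 1 ≤ i → 0 ≤ p i ∧ p i < 1 / 2)
include hp

lemma E_mul_U {i : ℕ} (hi : 1 ≤ i) : E p i * U p i = 1 - E p i := by
  have := (hp i hi).1
  rw [E, if_neg (by omega), U]
  field_simp
  ring

lemma U_pos {i : ℕ} (hi : 1 ≤ i) : 0 < U p i := by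
  have := hp i hi
  exact div_pos (by linarith) (by linarith)

lemma U_le_one {i : ℕ} (hi : 1 ≤ i) : U p i ≤ 1 := by
  have := hp i hi
  rw [U, div_le_one (by linarith)]
  linarith

lemma oddsProd_pos (m j : ℕ) : 0 < oddsProd p m j :=
  Finset.prod_pos fun _ _ => U_pos hp (by omega)

lemma ascentProb_nonneg (R j : ℕ) : 0 ≤ ascentProb p R j :=
  Finset.prod_nonneg fun _ _ => E_nonneg hp _

lemma scale_pos {m k : ℕ} (hk : 1 ≤ k) : 0 < scale p m k :=
  Finset.sum_pos (fun j _ => oddsProd_pos hp m j)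
    ⟨0, by simpa using Nat.lt_of_lt_of_le zero_lt_one hk⟩

/-- A function harmonic below `R` is constant up to `R`, because the origin is reflecting. -/
lemma eq_of_harmonic_below {f : ℕ → ℝ} {R : ℕ}
    (hf : ∀ x < R, f x = E p x * f (x + 1) + (1 - E p x) * f (x - 1)) :
    ∀ x ≤ R, f x = f 0 := by
  have key : ∀ x, x + 1 ≤ R → f (x + 1) = f x := by
    intro x
    induction x with
    | zero =>
      intro h
      have := hf 0 (by omega)
      rw [E_zero] at this
      linarith
    | succ x ih =>
      intro h
      have h1 := hf (x + 1) (by omega)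
      have h2 := ih (by omega)
      have h3 := half_le_E hp (x + 1)
      simp only [Nat.add_sub_cancel] at h1
      rw [← h2] at h1
      have : E p (x + 1) * (f (x + 1 + 1) - f (x + 1)) = 0 := by linarith
      rcases mul_eq_zero.1 this with h | h <;> linarith
  intro x
  induction x with
  | zero => intro _; rfl
  | succ x ih => intro h; rw [key x h, ih (by omega)]

/-- A function vanishing at `m` and harmonic between `m` and `m + k` is there a multiple of the
scale function. -/
lemma eq_scale_of_harmonic {f : ℕ → ℝ} {m k : ℕ} (h0 : f m = 0)
    (hf : ∀ x, m < x → x < m + k → f x = E p x * f (x + 1) + (1 - E p x) * f (x - 1)) :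
    ∀ j ≤ k, f (m + j) = f (m + 1) * scale p m j := by
  have key : ∀ j, j + 1 ≤ k → f (m + j + 1) - f (m + j) = f (m + 1) * oddsProd p m j := by
    intro j
    induction j with
    | zero => intro _; simp [h0, oddsProd]
    | succ j ih =>
      intro h
      have h1 := hf (m + j + 1) (by omega) (by omega)
      have h2 := ih (by omega)
      have h3 := half_le_E hp (m + j + 1)
      have h4 := E_mul_U hp (i := m + j + 1) (by omega)
      simp only [Nat.add_sub_cancel] at h1
      rw [oddsProd_succ, ← mul_assoc, ← h2, show m + 1 + j = m + j + 1 by ring,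
        show m + (j + 1) = m + j + 1 by ring]
      have hE : E p (m + j + 1) ≠ 0 := by linarith
      apply mul_left_cancel₀ hE
      linear_combination -(f (m + j + 1) - f (m + j)) * h4 - h1
  intro j
  induction j with
  | zero => intro _; simp [h0]
  | succ j ih =>
    intro h
    rw [scale_succ, mul_add, ← ih (by omega), ← key j h]
    ring_nf

/-- Harmonicity of the scale function. -/
lemma scale_harmonic (m k : ℕ) :
    scale p m (k + 1) = E p (m + k + 1) * scale p m (k + 2) +
      (1 - E p (m + k + 1)) * scale p m k := by
  have h := E_mul_U hp (i := m + k + 1) (by omega)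
  rw [scale_succ p m (k + 1), scale_succ p m k, oddsProd_succ, show m + 1 + k = m + k + 1 by ring]
  linear_combination -(oddsProd p m k) * h

end Recurrences

/-- The total local time of a path at `S`. -/
def visits (S : ℕ) (w : ℕ → ℕ) : ℝ≥0∞ := localTime (fun k (w : ℕ → ℕ) => w k) S w

lemma visits_pathCons (S x : ℕ) (w : ℕ → ℕ) :
    visits S (pathCons x w) = (if x = S then 1 else 0) + visits S w := by
  unfold visits localTime
  rw [tsum_eq_zero_add' ENNReal.summable]
  congr 1
  by_cases h : x = S <;> simp [h]

lemma measurable_visits (S : ℕ) : Measurable (visits S) := by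
  have : visits S = fun w => ∑' k, ({S} : Set ℕ).indicator (fun _ => (1 : ℝ≥0∞)) (w k) := by
    funext w
    simp [visits, localTime, Set.indicator_apply]
  rw [this]
  exact Measurable.tsum fun k =>
    (measurable_of_countable (({S} : Set ℕ).indicator fun _ => (1 : ℝ≥0∞))).comp
      (measurable_pi_apply k)

/-- The event that the sites `R, …, R + j - 1` are visited at most once. -/
def atMostOnce (R j : ℕ) : Set (ℕ → ℕ) := {w | ∀ i < j, visits (R + i) w ≤ 1}

/-- The event that `S` is never visited. -/
def never (S : ℕ) : Set (ℕ → ℕ) := {w | visits S w = 0}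

lemma measurableSet_atMostOnce (R j : ℕ) : MeasurableSet (atMostOnce R j) := by
  have : atMostOnce R j = ⋂ i, ⋂ (_ : i < j), visits (R + i) ⁻¹' Set.Iic 1 := by
    ext w; simp [atMostOnce]
  rw [this]
  exact MeasurableSet.iInter fun i => MeasurableSet.iInter fun _ =>
    measurable_visits _ measurableSet_Iic

lemma measurableSet_never (S : ℕ) : MeasurableSet (never S) :=
  measurable_visits S (measurableSet_singleton 0)

lemma preimage_never_of_ne {x S : ℕ} (h : x ≠ S) : pathCons x ⁻¹' never S = never S := by
  ext w
  simp [never, visits_pathCons, h]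

lemma preimage_never_self (S : ℕ) : pathCons S ⁻¹' never S = ∅ := by
  ext w
  simp [never, visits_pathCons]

lemma preimage_atMostOnce_of_lt {x R : ℕ} (h : x < R) (j : ℕ) :
    pathCons x ⁻¹' atMostOnce R j = atMostOnce R j := by
  ext w
  have : ∀ i, x ≠ R + i := fun i => by omega
  simp [atMostOnce, visits_pathCons, this]

lemma preimage_atMostOnce_self (R j : ℕ) :
    pathCons R ⁻¹' atMostOnce R (j + 1) = never R ∩ atMostOnce (R + 1) j := by
  ext w
  constructor
  · intro h
    constructor
    · have := h 0 (by omega)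
      rw [add_zero, visits_pathCons, if_pos rfl] at this
      by_contra hne
      have h1 : (1 : ℝ≥0∞) + visits R w ≤ 1 + 0 := by simpa using this
      exact hne (le_antisymm ((ENNReal.add_le_add_iff_left ENNReal.one_ne_top).1 h1) zero_le)
    · intro i hi
      have := h (i + 1) (by omega)
      rw [visits_pathCons, if_neg (by omega), zero_add] at this
      rwa [add_assoc, add_comm 1 i]
  · rintro ⟨h0, h⟩ (_ | i) hi
    · have h0' : visits R w = 0 := h0
      simp [visits_pathCons, h0']
    · have := h i (by omega)
      rw [visits_pathCons, if_neg (by omega), zero_add]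
      rwa [add_assoc, add_comm 1 i] at this

namespace IsPathFamily

variable {p : ℕ → ℝ} {μ : ℕ → Measure (ℕ → ℕ)}

section
variable (hμ : IsPathFamily p μ) (hp : ∀ i, 1 ≤ i → 0 ≤ p i ∧ p i < 1 / 2)
include hμ hp

/-- Events unaffected by the path before it reaches `S` have the same probability from all
starting points up to `S`. -/
lemma real_eq_of_invariant {S : ℕ} {G : Set (ℕ → ℕ)} (hG : MeasurableSet G)
    (hinv : ∀ x < S, pathCons x ⁻¹' G = G) {x : ℕ} (hx : x ≤ S) :
    (μ x).real G = (μ 0).real G := by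
  refine eq_of_harmonic_below hp (f := fun x => (μ x).real G) (R := S) (fun y hy => ?_) x hx
  have := hμ.first_step y G hG
  rwa [hinv y hy] at this

/-- The walk visits every site above its starting point almost surely. -/
lemma real_never_eq_zero {x S : ℕ} (hx : x ≤ S) : (μ x).real (never S) = 0 := by
  have hinv : ∀ y < S, pathCons y ⁻¹' never S = never S := fun y hy =>
    preimage_never_of_ne hy.ne
  rw [hμ.real_eq_of_invariant hp (measurableSet_never S) hinv hx,
    ← hμ.real_eq_of_invariant hp (measurableSet_never S) hinv le_rfl,
    hμ.first_step S _ (measurableSet_never S), preimage_never_self]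
  simp

/-- Gambler's ruin bound for escaping from `m` and then realising an event beyond `m + k`. -/
lemma real_never_inter_mul_scale_le {m k : ℕ} {G : Set (ℕ → ℕ)}
    (hG : MeasurableSet G) (hinv : ∀ x < m + k, pathCons x ⁻¹' G = G) :
    (μ (m + 1)).real (never m ∩ G) * scale p m k ≤ (μ 0).real G := by
  have := hμ.prob
  have hmeas := (measurableSet_never m).inter hG
  rw [← eq_scale_of_harmonic hp (f := fun x => (μ x).real (never m ∩ G)) (k := k) ?_ ?_ k le_rfl,
    ← hμ.real_eq_of_invariant hp hG hinv le_rfl]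
  · exact measureReal_mono Set.inter_subset_right
  · rw [hμ.first_step m _ hmeas, Set.preimage_inter, preimage_never_self]
    simp
  · intro x hx1 hx2
    have := hμ.first_step x _ hmeas
    rwa [Set.preimage_inter, preimage_never_of_ne hx1.ne', hinv x hx2] at this

lemma real_atMostOnce_inter_le_ascent (j : ℕ) {G : Set (ℕ → ℕ)} (hG : MeasurableSet G) :
    ∀ R, 1 ≤ R → (∀ x < R + j + 1, pathCons x ⁻¹' G = G) →
    (μ R).real (atMostOnce R (j + 1) ∩ G) ≤
      ascentProb p R (j + 1) * (μ (R + j + 1)).real (never (R + j) ∩ G) := by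
  have := hμ.prob
  have main : ∀ j R, 1 ≤ R → pathCons R ⁻¹' G = G →
      (μ R).real (atMostOnce R (j + 1) ∩ G) ≤
        E p R * (μ (R + 1)).real (never R ∩ atMostOnce (R + 1) j ∩ G) := by
    intro j R hR hinv
    rw [hμ.first_step R _ ((measurableSet_atMostOnce _ _).inter hG), Set.preimage_inter,
      preimage_atMostOnce_self, hinv]
    have h0 : (μ (R - 1)).real (never R ∩ atMostOnce (R + 1) j ∩ G) = 0 :=
      le_antisymm (by
        rw [← hμ.real_never_eq_zero hp (Nat.sub_le R 1)]
        exact measureReal_mono (Set.inter_subset_left.trans Set.inter_subset_left))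
        measureReal_nonneg
    rw [h0]
    simp
  induction j with
  | zero =>
    intro R hR hinv
    refine (main 0 R hR (hinv R (by omega))).trans_eq ?_
    simp [atMostOnce, ascentProb]
  | succ j ih =>
    intro R hR hinv
    refine (main (j + 1) R hR (hinv R (by omega))).trans ?_
    rw [ascentProb_succ', mul_assoc]
    refine mul_le_mul_of_nonneg_left ?_ (E_nonneg hp R)
    have := ih (R + 1) (by omega) fun x hx => hinv x (by omega)
    rw [show R + 1 + j = R + (j + 1) by ring] at this
    refine le_trans (measureReal_mono ?_) this
    exact Set.inter_subset_inter_left _ Set.inter_subset_right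

/-- Upper bound for a run of once-visited sites followed by an event beyond `R + j + k`. -/
lemma real_atMostOnce_inter_mul_scale_le {R j k : ℕ} (hR : 1 ≤ R) (hk : 1 ≤ k)
    {G : Set (ℕ → ℕ)} (hG : MeasurableSet G) (hinv : ∀ x < R + j + k, pathCons x ⁻¹' G = G) :
    (μ 0).real (atMostOnce R (j + 1) ∩ G) * scale p (R + j) k ≤
      ascentProb p R (j + 1) * (μ 0).real G := by
  have hmeas := (measurableSet_atMostOnce R (j + 1)).inter hG
  have h1 := hμ.real_atMostOnce_inter_le_ascent hp j hG R hR fun x hx => hinv x (by omega)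
  have h2 := hμ.real_never_inter_mul_scale_le hp hG hinv
  rw [← hμ.real_eq_of_invariant hp hmeas (S := R) (x := R) (fun x hx => by
    rw [Set.preimage_inter, preimage_atMostOnce_of_lt hx, hinv x (by omega)]) le_rfl]
  calc _ ≤ ascentProb p R (j + 1) * (μ (R + j + 1)).real (never (R + j) ∩ G) *
        scale p (R + j) k := mul_le_mul_of_nonneg_right h1 (scale_pos hp hk).le
    _ ≤ _ := by
      rw [mul_assoc]
      exact mul_le_mul_of_nonneg_left h2 (ascentProb_nonneg hp _ _)

end

end IsPathFamily

/-- The event that the path stays at or above `R` up to time `N - 1`. -/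
def staysAbove (R N : ℕ) : Set (ℕ → ℕ) := {w | ∀ k < N, R ≤ w k}

lemma measurableSet_staysAbove (R N : ℕ) : MeasurableSet (staysAbove R N) := by
  have : staysAbove R N = ⋂ k, ⋂ (_ : k < N), (fun w : ℕ → ℕ => w k) ⁻¹' Set.Ici R := by
    ext w; simp [staysAbove]
  rw [this]
  exact MeasurableSet.iInter fun k => MeasurableSet.iInter fun _ =>
    measurable_pi_apply k measurableSet_Ici

lemma preimage_staysAbove {x R : ℕ} (h : R ≤ x) (N : ℕ) :
    pathCons x ⁻¹' staysAbove R (N + 1) = staysAbove R N := by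
  ext w
  constructor
  · intro hw k hk
    exact hw (k + 1) (by omega)
  · rintro hw (_ | k) hk
    · exact h
    · exact hw k (by omega)

namespace IsPathFamily

variable {p : ℕ → ℝ} {μ : ℕ → Measure (ℕ → ℕ)}
variable (hμ : IsPathFamily p μ) (hp : ∀ i, 1 ≤ i → 0 ≤ p i ∧ p i < 1 / 2)
include hμ hp

/-- The walk escapes from level `m` at least as likely as the scale function predicts. -/
lemma scale_le_mul_real_staysAbove {m : ℕ} {D : ℝ} (hD : ∀ k, scale p m k ≤ D) (N : ℕ) :
    ∀ x, scale p m (x - m) ≤ D * (μ x).real (staysAbove (m + 1) N) := by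
  have := hμ.prob
  have hD0 : 0 ≤ D := by simpa using hD 0
  induction N with
  | zero =>
    intro x
    have : staysAbove (m + 1) 0 = Set.univ := by ext; simp [staysAbove]
    simpa [this] using hD (x - m)
  | succ N ih =>
    intro x
    rcases le_or_gt x m with h | h
    · rw [Nat.sub_eq_zero_of_le h, scale_zero]
      exact mul_nonneg hD0 measureReal_nonneg
    · obtain ⟨k, rfl⟩ := Nat.exists_eq_add_of_lt h
      rw [hμ.first_step _ _ (measurableSet_staysAbove _ _), preimage_staysAbove (by omega)]
      have h1 := ih (m + k + 1 + 1)
      have h2 := ih (m + k + 1 - 1)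
      rw [show m + k + 1 + 1 - m = k + 2 by omega] at h1
      rw [show m + k + 1 - 1 - m = k by omega] at h2
      rw [show m + k + 1 - m = k + 1 by omega, scale_harmonic hp m k]
      have hE0 := E_nonneg hp (m + k + 1)
      have hE1 := E_le_one hp (m + k + 1)
      have h3 := mul_le_mul_of_nonneg_left h1 hE0
      have h4 := mul_le_mul_of_nonneg_left h2 (sub_nonneg.2 hE1)
      linarith

lemma one_le_mul_real_forall_ge {m : ℕ} {D : ℝ} (hD : ∀ k, scale p m k ≤ D) :
    1 ≤ D * (μ (m + 1)).real {w | ∀ k, m + 1 ≤ w k} := by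
  have := hμ.prob
  have hset : {w : ℕ → ℕ | ∀ k, m + 1 ≤ w k} = ⋂ N, staysAbove (m + 1) N := by
    ext w
    simp only [Set.mem_ofPred_eq, Set.mem_iInter, staysAbove]
    exact ⟨fun h N k _ => h k, fun h k => h (k + 1) k (by omega)⟩
  have hanti : Antitone (staysAbove (m + 1)) := fun N N' h w hw k hk => hw k (hk.trans_le h)
  have hlim := tendsto_measure_iInter_atTop (μ := μ (m + 1))
    (fun N => (measurableSet_staysAbove (m + 1) N).nullMeasurableSet) hanti
    ⟨0, measure_ne_top _ _⟩
  have hlim' := (ENNReal.tendsto_toReal (measure_ne_top _ _)).comp hlim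
  rw [hset]
  refine ge_of_tendsto' (hlim'.const_mul D) fun N => ?_
  have := hμ.scale_le_mul_real_staysAbove hp hD N (m + 1)
  rwa [Nat.add_sub_cancel_left, scale_one] at this

/-- Lower bound for a run of once-visited sites. -/
lemma ascentProb_le_mul_real_atMostOnce {R j : ℕ} {D : ℝ}
    (hD : ∀ k, scale p (R + j) k ≤ D) :
    ascentProb p R (j + 1) ≤ D * (μ 0).real (atMostOnce R (j + 1)) := by
  have := hμ.prob
  have hD0 : 0 ≤ D := by simpa using hD 0
  have hmV : ∀ R, MeasurableSet {w : ℕ → ℕ | ∀ k, R ≤ w k} := fun R => by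
    have : {w : ℕ → ℕ | ∀ k, R ≤ w k} = ⋂ k, (fun w : ℕ → ℕ => w k) ⁻¹' Set.Ici R := by
      ext w; simp
    rw [this]
    exact MeasurableSet.iInter fun k => measurable_pi_apply k measurableSet_Ici
  have key : ∀ j R, ascentProb p R j * (μ (R + j)).real {w | ∀ k, R + j ≤ w k} ≤
      (μ R).real ({w | ∀ k, R ≤ w k} ∩ atMostOnce R j) := by
    intro j
    induction j with
    | zero => intro R; simp [ascentProb, atMostOnce]
    | succ j ih =>
      intro R
      have h := ih (R + 1)
      rw [show R + 1 + j = R + (j + 1) by ring] at h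
      rw [ascentProb_succ', mul_assoc, hμ.first_step R _ ((hmV R).inter
        (measurableSet_atMostOnce _ _))]
      have h2 : 0 ≤ (1 - E p R) * (μ (R - 1)).real
          (pathCons R ⁻¹' ({w | ∀ k, R ≤ w k} ∩ atMostOnce R (j + 1))) :=
        mul_nonneg (by linarith [E_le_one hp R]) measureReal_nonneg
      refine le_trans (mul_le_mul_of_nonneg_left (h.trans (measureReal_mono ?_))
        (E_nonneg hp R)) (le_add_of_nonneg_right h2)
      rintro w ⟨hw1, hw2⟩
      refine ⟨?_, ?_⟩
      · rintro (_ | k)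
        · exact le_rfl
        · exact (Nat.le_succ R).trans (hw1 k)
      · change w ∈ pathCons R ⁻¹' atMostOnce R (j + 1)
        rw [preimage_atMostOnce_self]
        refine ⟨?_, hw2⟩
        have : ∀ k, w k ≠ R := fun k => by have := hw1 k; omega
        simp [never, visits, localTime, this]
  have h1 := key (j + 1) R
  have h2 := hμ.one_le_mul_real_forall_ge hp hD
  rw [show R + j + 1 = R + (j + 1) by ring] at h2
  rw [← hμ.real_eq_of_invariant hp (measurableSet_atMostOnce R (j + 1)) (S := R) (x := R)
    (fun x hx => preimage_atMostOnce_of_lt hx _) le_rfl]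
  have h3 : (μ R).real ({w | ∀ k, R ≤ w k} ∩ atMostOnce R (j + 1)) ≤
      (μ R).real (atMostOnce R (j + 1)) := measureReal_mono Set.inter_subset_right
  calc ascentProb p R (j + 1) ≤ ascentProb p R (j + 1) *
        (D * (μ (R + (j + 1))).real {w | ∀ k, R + (j + 1) ≤ w k}) :=
        le_mul_of_one_le_right (ascentProb_nonneg hp _ _) h2
    _ = D * (ascentProb p R (j + 1) * (μ (R + (j + 1))).real {w | ∀ k, R + (j + 1) ≤ w k}) := by
        ring
    _ ≤ _ := mul_le_mul_of_nonneg_left (h1.trans h3) hD0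

end IsPathFamily

/-- Second Borel-Cantelli lemma for events whose pair correlations exceed the independent ones by
a summable amount. -/
lemma ae_frequently_mem_of_sum_inter_le {Ω : Type*} [MeasurableSpace Ω] {P : Measure Ω}
    [IsProbabilityMeasure P] {A : ℕ → Set Ω} (hA : ∀ n, MeasurableSet (A n)) {C : ℝ} {R₀ : ℕ}
    (hpair : ∀ R, R₀ ≤ R → ∀ n, ∑ S ∈ Finset.Ico (R + 1) n, P.real (A R ∩ A S) ≤
      P.real (A R) * (C + ∑ S ∈ Finset.Ico (R + 1) n, P.real (A S)))
    (hdiv : ¬ Summable fun n => P.real (A n)) :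
    ∀ᵐ ω ∂P, ∃ᶠ n in atTop, ω ∈ A n := by
  classical
  set T : ℕ → ℕ → Ω → ℝ := fun R n ω => ∑ S ∈ Finset.Ico R n, (A S).indicator 1 ω with hT
  set M : ℕ → ℕ → ℝ := fun R n => ∑ S ∈ Finset.Ico R n, P.real (A S) with hM
  have hind : ∀ S, Integrable ((A S).indicator (1 : Ω → ℝ)) P := fun S =>
    (integrable_const (1 : ℝ)).indicator (hA S)
  have hTint : ∀ R n, Integrable (T R n) P := fun R n =>
    integrable_finsetSum _ fun S _ => hind S
  have hTmean : ∀ R n, ∫ ω, T R n ω ∂P = M R n := by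
    intro R n
    rw [hT, hM]
    simp only
    rw [integral_finsetSum _ fun S _ => hind S]
    exact Finset.sum_congr rfl fun S _ => integral_indicator_one (hA S)
  have hTind : ∀ R n Q, Integrable (fun ω => T R n ω * (A Q).indicator 1 ω) P := by
    intro R n Q
    have : (fun ω => T R n ω * (A Q).indicator 1 ω) = (A Q).indicator (T R n) := by
      ext ω
      by_cases h : ω ∈ A Q <;> simp [h]
    rw [this]
    exact (hTint R n).indicator (hA Q)
  have hTsq : ∀ R n, Integrable (fun ω => T R n ω ^ 2) P := by
    intro R n
    have : (fun ω => T R n ω ^ 2) =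
        fun ω => ∑ S ∈ Finset.Ico R n, T R n ω * (A S).indicator 1 ω := by
      ext ω
      rw [← Finset.mul_sum, sq]
    rw [this]
    exact integrable_finsetSum _ fun S _ => hTind R n S
  have hcross : ∀ R n, ∫ ω, T (R + 1) n ω * (A R).indicator 1 ω ∂P =
      ∑ S ∈ Finset.Ico (R + 1) n, P.real (A R ∩ A S) := by
    intro R n
    have : (fun ω => T (R + 1) n ω * (A R).indicator 1 ω) =
        fun ω => ∑ S ∈ Finset.Ico (R + 1) n, (A R ∩ A S).indicator 1 ω := by
      ext ω
      rw [hT]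
      simp only
      rw [Finset.sum_mul]
      refine Finset.sum_congr rfl fun S _ => ?_
      by_cases h1 : ω ∈ A R <;> by_cases h2 : ω ∈ A S <;> simp [h1, h2]
    have hind2 : ∀ S, Integrable ((A R ∩ A S).indicator (1 : Ω → ℝ)) P := fun S =>
      (integrable_const (1 : ℝ)).indicator ((hA R).inter (hA S))
    rw [this, integral_finsetSum _ fun S _ => hind2 S]
    exact Finset.sum_congr rfl fun S _ => integral_indicator_one ((hA R).inter (hA S))
  have hsecond : ∀ k R, R₀ ≤ R → ∫ ω, T R (R + k) ω ^ 2 ∂P ≤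
      M R (R + k) ^ 2 + (2 * C + 1) * M R (R + k) := by
    intro k
    induction k with
    | zero => intro R _; simp [hT, hM]
    | succ k ih =>
      intro R hR
      have hlt : R < R + (k + 1) := by omega
      have hTR : ∀ ω, T R (R + (k + 1)) ω = (A R).indicator 1 ω + T (R + 1) (R + (k + 1)) ω :=
        fun ω => Finset.sum_eq_sum_Ico_succ_bot hlt _
      have hMR : M R (R + (k + 1)) = P.real (A R) + M (R + 1) (R + (k + 1)) :=
        Finset.sum_eq_sum_Ico_succ_bot hlt _
      have h1 := ih (R + 1) (by omega)
      rw [show R + 1 + k = R + (k + 1) by ring] at h1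
      have h2 := hpair R hR (R + (k + 1))
      rw [← hcross] at h2
      change _ ≤ P.real (A R) * (C + M (R + 1) (R + (k + 1))) at h2
      have hexp : ∫ ω, T R (R + (k + 1)) ω ^ 2 ∂P = P.real (A R) +
          2 * ∫ ω, T (R + 1) (R + (k + 1)) ω * (A R).indicator 1 ω ∂P +
          ∫ ω, T (R + 1) (R + (k + 1)) ω ^ 2 ∂P := by
        have : (fun ω => T R (R + (k + 1)) ω ^ 2) = fun ω => ((A R).indicator 1 ω +
            2 * (T (R + 1) (R + (k + 1)) ω * (A R).indicator 1 ω)) +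
            T (R + 1) (R + (k + 1)) ω ^ 2 := by
          ext ω
          rw [hTR]
          by_cases h : ω ∈ A R <;> simp [h]
          ring
        have hI : Integrable (fun ω => (A R).indicator 1 ω +
            2 * (T (R + 1) (R + (k + 1)) ω * (A R).indicator 1 ω)) P :=
          (hind R).add ((hTind _ _ _).const_mul 2)
        rw [this, integral_add hI (hTsq _ _),
          integral_add (hind R) ((hTind _ _ _).const_mul 2), integral_const_mul,
          integral_indicator_one (hA R)]
      rw [hexp, hMR]
      nlinarith [sq_nonneg (P.real (A R))]
  have hMtop : Tendsto (fun k => M R₀ (R₀ + k)) atTop atTop := by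
    have h1 := (not_summable_iff_tendsto_nat_atTop_of_nonneg
      (fun n => measureReal_nonneg (μ := P) (s := A n))).1 hdiv
    have h2 : Tendsto (fun k => R₀ + k) atTop atTop :=
      tendsto_atTop_mono (fun k => Nat.le_add_left k R₀) tendsto_id
    have h3 := tendsto_atTop_add_const_right _ (-∑ i ∈ Finset.range R₀, P.real (A i)) (h1.comp h2)
    refine h3.congr fun k => ?_
    simp only [hM, Function.comp]
    rw [Finset.sum_Ico_eq_sub _ (by omega), sub_eq_add_neg]
  have hbounded : ∀ K : ℕ, P {ω | ∀ n, T R₀ n ω ≤ K} = 0 := by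
    intro K
    rw [← measureReal_eq_zero_iff]
    refine le_antisymm ?_ measureReal_nonneg
    have hlim : Tendsto (fun k => 4 * (2 * C + 1) / M R₀ (R₀ + k)) atTop (𝓝 0) :=
      Tendsto.const_div_atTop hMtop _
    refine ge_of_tendsto hlim ?_
    filter_upwards [hMtop.eventually_ge_atTop (2 * (K : ℝ) + 1)] with k hk
    set m := M R₀ (R₀ + k) with hm
    set t := T R₀ (R₀ + k) with ht
    have hK : (0 : ℝ) ≤ K := Nat.cast_nonneg K
    have hmpos : 0 < m := by linarith
    have hint : Integrable (fun ω => (t ω - m) ^ 2) P := by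
      have : (fun ω => (t ω - m) ^ 2) = fun ω => (t ω ^ 2 - (2 * m) * t ω) + m ^ 2 := by
        ext ω; ring
      rw [this]
      exact ((hTsq _ _).sub ((hTint _ _).const_mul _)).add (integrable_const _)
    have hvar : ∫ ω, (t ω - m) ^ 2 ∂P ≤ (2 * C + 1) * m := by
      have : (fun ω => (t ω - m) ^ 2) = fun ω => (t ω ^ 2 - (2 * m) * t ω) + m ^ 2 := by
        ext ω; ring
      have hI : Integrable (fun ω => t ω ^ 2 - (2 * m) * t ω) P :=
        (hTsq _ _).sub ((hTint _ _).const_mul _)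
      rw [this, integral_add hI (integrable_const _),
        integral_sub (hTsq _ _) ((hTint _ _).const_mul _), integral_const_mul, hTmean,
        integral_const]
      have := hsecond k R₀ le_rfl
      rw [← hm] at this ⊢
      simp only [probReal_univ, smul_eq_mul, one_mul]
      rw [← ht] at this
      linarith
    have hmarkov := mul_meas_ge_le_integral_of_nonneg
      (Eventually.of_forall fun ω => sq_nonneg (t ω - m)) hint (m ^ 2 / 4)
    have hsub : P.real {ω | ∀ n, T R₀ n ω ≤ K} ≤ P.real {ω | m ^ 2 / 4 ≤ (t ω - m) ^ 2} := by
      refine measureReal_mono fun ω hω => ?_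
      have h1 : t ω ≤ K := hω (R₀ + k)
      change m ^ 2 / 4 ≤ (t ω - m) ^ 2
      nlinarith
    rw [le_div_iff₀ hmpos]
    have h4 : m ^ 2 / 4 * P.real {ω | ∀ n, T R₀ n ω ≤ K} ≤ (2 * C + 1) * m :=
      (mul_le_mul_of_nonneg_left hsub (by positivity)).trans (hmarkov.trans hvar)
    have h5 : m * (P.real {ω | ∀ n, T R₀ n ω ≤ K} * m) ≤ m * (4 * (2 * C + 1)) := by nlinarith
    exact le_of_mul_le_mul_left h5 hmpos
  have hae : ∀ᵐ ω ∂P, ∀ K : ℕ, ¬ ∀ n, T R₀ n ω ≤ K := by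
    rw [ae_all_iff]
    intro K
    rw [ae_iff]
    simpa using hbounded K
  filter_upwards [hae] with ω hω
  by_contra hfin
  rw [not_frequently, eventually_atTop] at hfin
  obtain ⟨N, hN⟩ := hfin
  refine hω N fun n => ?_
  calc T R₀ n ω ≤ ∑ S ∈ Finset.Ico R₀ n, if S < N then (1 : ℝ) else 0 := by
        refine Finset.sum_le_sum fun S _ => ?_
        split_ifs with h
        · exact Set.indicator_le_self' (fun _ _ => zero_le_one) ω
        · simp [hN S (by omega)]
    _ = (((Finset.Ico R₀ n).filter (· < N)).card : ℝ) := by simp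
    _ ≤ N := by
        have : ((Finset.Ico R₀ n).filter (· < N)) ⊆ Finset.range N := by
          intro S hS
          simpa using (Finset.mem_filter.1 hS).2
        have := Finset.card_le_card this
        rw [Finset.card_range] at this
        exact_mod_cast this

section ScaleEstimates

variable {p : ℕ → ℝ}

lemma scale_succ' (p : ℕ → ℝ) (m k : ℕ) :
    scale p m (k + 1) = 1 + U p (m + 1) * scale p (m + 1) k := by
  have h0 : oddsProd p m 0 = 1 := by simp [oddsProd]
  rw [scale, Finset.sum_range_succ', scale, Finset.mul_sum, h0, add_comm (1 : ℝ)]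
  congr 1
  refine Finset.sum_congr rfl fun j _ => ?_
  rw [oddsProd, Finset.prod_range_succ', oddsProd, mul_comm]
  congr 1
  exact Finset.prod_congr rfl fun i _ => by rw [show m + 1 + (i + 1) = m + 1 + 1 + i by ring]

lemma oddsProd_add (p : ℕ → ℝ) (m k j : ℕ) :
    oddsProd p m (k + j) = oddsProd p m k * oddsProd p (m + k) j := by
  rw [oddsProd, Finset.prod_range_add, oddsProd, oddsProd]
  congr 1
  exact Finset.prod_congr rfl fun i _ => by rw [show m + 1 + (k + i) = m + k + 1 + i by ring]

lemma ascentProb_add (p : ℕ → ℝ) (R k j : ℕ) :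
    ascentProb p R (k + j) = ascentProb p R k * ascentProb p (R + k) j := by
  rw [ascentProb, Finset.prod_range_add, ascentProb, ascentProb]
  congr 1
  exact Finset.prod_congr rfl fun i _ => by rw [add_assoc]

lemma p_le_of_le (hanti : ∀ i, 1 ≤ i → p (i + 1) ≤ p i) {i j : ℕ} (hi : 1 ≤ i) (hij : i ≤ j) :
    p j ≤ p i := by
  induction j, hij using Nat.le_induction with
  | base => exact le_rfl
  | succ j hj ih => exact (hanti j (by omega)).trans ih

variable (hp : ∀ i, 1 ≤ i → 0 ≤ p i ∧ p i < 1 / 2)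
include hp

/-- A supersolution of the recursion of the scale function bounds it. -/
lemma scale_le_of_supersolution {h : ℕ → ℝ} {m₀ : ℕ} (h0 : ∀ m, 0 ≤ h m)
    (hsup : ∀ m, m₀ ≤ m → 1 + U p (m + 1) * h (m + 1) ≤ h m) (k : ℕ) :
    ∀ m, m₀ ≤ m → scale p m k ≤ h m := by
  induction k with
  | zero => intro m _; simpa using h0 m
  | succ k ih =>
    intro m hm
    rw [scale_succ']
    have := mul_le_mul_of_nonneg_left (ih (m + 1) (by omega)) (U_pos hp (i := m + 1) (by omega)).le
    linarith [hsup m hm]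

lemma oddsProd_antitone (m : ℕ) : Antitone (oddsProd p m) :=
  antitone_nat_of_succ_le fun k => by
    rw [oddsProd_succ]
    exact mul_le_of_le_one_right (oddsProd_pos hp m k).le (U_le_one hp (by omega))

lemma mul_oddsProd_le_scale (m k : ℕ) : k * oddsProd p m k ≤ scale p m k := by
  have : ∑ _j ∈ Finset.range k, oddsProd p m k ≤ scale p m k :=
    Finset.sum_le_sum fun j hj => oddsProd_antitone hp m (Finset.mem_range.1 hj).le
  simpa using this

variable (hanti : ∀ i, 1 ≤ i → p (i + 1) ≤ p i)
include hanti

lemma U_le_of_le {i j : ℕ} (hi : 1 ≤ i) (hij : i ≤ j) : U p i ≤ U p j := by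
  have h1 := p_le_of_le hanti hi hij
  have h2 := hp i hi
  have h3 := hp j (by omega)
  rw [U, U, div_le_div_iff₀ (by linarith) (by linarith)]
  nlinarith

lemma oddsProd_le_of_le {m m' : ℕ} (h : m ≤ m') (j : ℕ) : oddsProd p m j ≤ oddsProd p m' j :=
  Finset.prod_le_prod (fun i _ => (U_pos hp (by omega)).le)
    fun i _ => U_le_of_le hp hanti (by omega) (by omega)

lemma one_sub_le_oddsProd (m j : ℕ) : 1 - 4 * p (m + 1) * j ≤ oddsProd p m j := by
  have hm := hp (m + 1) (by omega)
  rcases le_or_gt (p (m + 1)) (1 / 4) with hle | hgt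
  · have h1 : (1 - 4 * p (m + 1)) ^ j ≤ oddsProd p m j := by
      rw [oddsProd, ← Finset.card_range j, ← Finset.prod_const, Finset.card_range]
      refine Finset.prod_le_prod (fun i _ => by linarith) fun i _ => ?_
      have h2 := p_le_of_le hanti (i := m + 1) (j := m + 1 + i) (by omega) (by omega)
      have h3 := hp (m + 1 + i) (by omega)
      rw [U, le_div_iff₀ (by linarith)]
      nlinarith
    have h2 := one_add_mul_le_pow (a := -(4 * p (m + 1))) (by linarith) j
    rw [← sub_eq_add_neg] at h2
    refine le_trans (le_of_eq ?_) (h2.trans h1)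
    ring
  · rcases Nat.eq_zero_or_pos j with rfl | hj
    · simp [oddsProd]
    · have : (1 : ℝ) ≤ j := by exact_mod_cast hj
      have := oddsProd_pos hp m j
      nlinarith

end ScaleEstimates

section Potential

variable {p : ℕ → ℝ}

/-- The total mass `D(m,∞)` as a real number. -/
def scaleTop (p : ℕ → ℝ) (m : ℕ) : ℝ := ∑' j, oddsProd p m j

lemma scaleTop_eq_add {m : ℕ} (hs : Summable (oddsProd p m)) (k : ℕ) :
    scaleTop p m = scale p m k + oddsProd p m k * scaleTop p (m + k) := by
  rw [scaleTop, ← hs.sum_add_tsum_nat_add k, scaleTop, ← tsum_mul_left, scale]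
  congr 1
  exact tsum_congr fun j => by rw [add_comm, oddsProd_add]

variable (hp : ∀ i, 1 ≤ i → 0 ≤ p i ∧ p i < 1 / 2)
include hp

lemma scale_le_scaleTop {m : ℕ} (hs : Summable (oddsProd p m)) (k : ℕ) :
    scale p m k ≤ scaleTop p m :=
  hs.sum_le_tsum _ fun j _ => (oddsProd_pos hp m j).le

lemma scaleTop_pos {m : ℕ} (hs : Summable (oddsProd p m)) : 0 < scaleTop p m :=
  zero_lt_one.trans_le (by simpa using scale_le_scaleTop hp hs 1)

lemma scaleTop_le_of_le (hanti : ∀ i, 1 ≤ i → p (i + 1) ≤ p i) {m m' : ℕ} (h : m ≤ m')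
    (hs : Summable (oddsProd p m)) (hs' : Summable (oddsProd p m')) :
    scaleTop p m ≤ scaleTop p m' :=
  hs.tsum_le_tsum (fun j => oddsProd_le_of_le hp hanti h j) hs'

namespace IsPathFamily

variable {μ : ℕ → Measure (ℕ → ℕ)} (hμ : IsPathFamily p μ)
include hμ

lemma real_atMostOnce_mul_scale_le {R j k : ℕ} (hR : 1 ≤ R) (hk : 1 ≤ k) :
    (μ 0).real (atMostOnce R (j + 1)) * scale p (R + j) k ≤ ascentProb p R (j + 1) := by
  have := hμ.prob
  have h := hμ.real_atMostOnce_inter_mul_scale_le hp (j := j) hR hk MeasurableSet.univ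
    fun x _ => Set.preimage_univ
  simpa using h

lemma real_atMostOnce_mul_scaleTop_le {R j : ℕ} (hR : 1 ≤ R)
    (hs : Summable (oddsProd p (R + j))) :
    (μ 0).real (atMostOnce R (j + 1)) * scaleTop p (R + j) ≤ ascentProb p R (j + 1) := by
  refine le_of_tendsto (hs.hasSum.tendsto_sum_nat.const_mul _) ?_
  filter_upwards [eventually_ge_atTop 1] with k hk
  exact hμ.real_atMostOnce_mul_scale_le hp hR hk

/-- Correlation bound for two separated runs of once-visited sites. -/
lemma real_inter_le_of_separated (hanti : ∀ i, 1 ≤ i → p (i + 1) ≤ p i) {R j k j' : ℕ}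
    (hR : 1 ≤ R) (hk : 1 ≤ k) (hs : ∀ m, R ≤ m → Summable (oddsProd p m)) :
    (μ 0).real (atMostOnce R (j + 1) ∩ atMostOnce (R + j + k) (j' + 1)) ≤
      (μ 0).real (atMostOnce R (j + 1)) * ((μ 0).real (atMostOnce (R + j + k) (j' + 1)) +
        ascentProb p (R + j + k) (j' + 1) / k) := by
  set a := (μ 0).real (atMostOnce R (j + 1))
  set b := (μ 0).real (atMostOnce (R + j + k) (j' + 1))
  set σ := scale p (R + j) k
  have hσ : 0 < σ := scale_pos hp hk
  have hk' : (0 : ℝ) < k := by exact_mod_cast hk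
  have ha : 0 ≤ a := measureReal_nonneg
  have hb : 0 ≤ b := measureReal_nonneg
  have h1 := hμ.real_atMostOnce_inter_mul_scale_le hp (j := j) hR hk
    (measurableSet_atMostOnce (R + j + k) (j' + 1))
    fun x hx => preimage_atMostOnce_of_lt hx _
  have h2 := hμ.ascentProb_le_mul_real_atMostOnce hp (R := R) (j := j)
    (scale_le_scaleTop hp (hs (R + j) (by omega)))
  have h3 := scaleTop_eq_add (hs (R + j) (by omega)) k
  have h4 := mul_oddsProd_le_scale hp (R + j) k
  have hDS := scaleTop_pos hp (hs (R + j + k) (by omega))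
  have h5 : b * scaleTop p (R + j + k) ≤ ascentProb p (R + j + k) (j' + 1) :=
    (mul_le_mul_of_nonneg_left (scaleTop_le_of_le hp hanti (by omega) (hs _ (by omega))
      (hs (R + j + k + j') (by omega))) hb).trans
      (hμ.real_atMostOnce_mul_scaleTop_le hp (by omega) (hs _ (by omega)))
  have h6 : oddsProd p (R + j) k ≤ σ / k := by
    rw [le_div_iff₀ hk', mul_comm]
    exact h4
  refine le_of_mul_le_mul_right (h1.trans ?_) hσ
  calc ascentProb p R (j + 1) * b ≤ scaleTop p (R + j) * a * b :=
        mul_le_mul_of_nonneg_right h2 hb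
    _ = a * (b * σ + oddsProd p (R + j) k * (b * scaleTop p (R + j + k))) := by
        rw [h3]; ring
    _ ≤ a * (b * σ + σ / k * ascentProb p (R + j + k) (j' + 1)) := by
        gcongr
    _ = _ := by ring

/-- Correlation bound for two overlapping runs of once-visited sites. -/
lemma real_inter_le_of_overlap (hanti : ∀ i, 1 ≤ i → p (i + 1) ≤ p i) {R j i j' : ℕ} {r : ℝ}
    (hR : 1 ≤ R) (hi : i ≤ j) (hj : j ≤ j') (hr1 : r ≤ 1)
    (hr : ∀ S l, R ≤ S → ascentProb p S l ≤ r ^ l) (hs : ∀ m, R ≤ m → Summable (oddsProd p m)) :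
    (μ 0).real (atMostOnce R (j + 1) ∩ atMostOnce (R + i) (j' + 1)) ≤
      (μ 0).real (atMostOnce R (j + 1)) * r ^ i := by
  have := hμ.prob
  have hr0 : 0 ≤ r := by simpa using (ascentProb_nonneg hp R 1).trans (hr R 1 le_rfl)
  have hsub : atMostOnce R (j + 1) ∩ atMostOnce (R + i) (j' + 1) ⊆
      atMostOnce R (i + j' + 1) := by
    rintro w ⟨h1, h2⟩ l hl
    rcases Nat.lt_or_ge l (j + 1) with h | h
    · exact h1 l h
    · have := h2 (l - i) (by omega)
      rwa [show R + i + (l - i) = R + l by omega] at this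
  refine (measureReal_mono hsub).trans ?_
  have hD := scaleTop_pos hp (hs (R + (i + j')) (by omega))
  have h1 := hμ.real_atMostOnce_mul_scaleTop_le hp (j := i + j') hR (hs _ (by omega))
  have h2 := hμ.ascentProb_le_mul_real_atMostOnce hp (R := R) (j := j)
    (scale_le_scaleTop hp (hs (R + j) (by omega)))
  have h3 : scaleTop p (R + j) ≤ scaleTop p (R + (i + j')) :=
    scaleTop_le_of_le hp hanti (by omega) (hs _ (by omega)) (hs _ (by omega))
  have h4 : ascentProb p R (i + j' + 1) ≤ ascentProb p R (j + 1) * r ^ i := by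
    rw [show i + j' + 1 = j + 1 + (i + (j' - j)) by omega, ascentProb_add]
    refine mul_le_mul_of_nonneg_left ((hr _ _ (by omega)).trans ?_) (ascentProb_nonneg hp _ _)
    exact pow_le_pow_of_le_one hr0 hr1 (by omega)
  refine le_of_mul_le_mul_right (h1.trans (h4.trans ?_)) hD
  calc ascentProb p R (j + 1) * r ^ i
      ≤ scaleTop p (R + (i + j')) * (μ 0).real (atMostOnce R (j + 1)) * r ^ i := by
        refine mul_le_mul_of_nonneg_right (h2.trans ?_) (pow_nonneg hr0 _)
        exact mul_le_mul_of_nonneg_right h3 measureReal_nonneg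
    _ = _ := by ring

end IsPathFamily

end Potential

section Asymptotics

variable {B α : ℝ} {p : ℕ → ℝ}

lemma IsTruncation.succ_le (hB : 0 < B) (hα0 : 0 < α)
    (htr : IsTruncation (fun i : ℕ => B / (4 * (i : ℝ) ^ α)) p) (i : ℕ) (hi : 1 ≤ i) :
    p (i + 1) ≤ p i := by
  obtain ⟨i0, h1, -, -, hle, hgt⟩ := htr
  have hq : B / (4 * ((i + 1 : ℕ) : ℝ) ^ α) ≤ B / (4 * (i : ℝ) ^ α) := by
    have : (0 : ℝ) < i := by exact_mod_cast hi
    have h2 : (i : ℝ) ^ α ≤ ((i + 1 : ℕ) : ℝ) ^ α :=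
      Real.rpow_le_rpow this.le (by push_cast; linarith) hα0.le
    have h3 : 0 < (i : ℝ) ^ α := Real.rpow_pos_of_pos this α
    gcongr
  rcases Nat.lt_or_ge i0 (i + 1) with h | h
  · rw [hgt (i + 1) h]
    rcases Nat.lt_or_ge i0 i with h' | h'
    · rwa [hgt i h']
    · obtain rfl : i = i0 := by omega
      rwa [hle i hi le_rfl]
  · rw [hle (i + 1) (by omega) h, hle i hi (by omega)]

lemma IsTruncation.eventually_eq {q : ℕ → ℝ} (htr : IsTruncation q p) :
    ∀ᶠ i in atTop, p i = q i := by
  obtain ⟨i0, -, -, -, -, hgt⟩ := htr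
  filter_upwards [eventually_gt_atTop i0] with i hi using hgt i hi

lemma tendsto_natCast_rpow_atTop (hα0 : 0 < α) :
    Tendsto (fun n : ℕ => (n : ℝ) ^ α) atTop atTop :=
  (tendsto_rpow_atTop hα0).comp tendsto_natCast_atTop_atTop

lemma IsTruncation.tendsto_zero (hα0 : 0 < α)
    (htr : IsTruncation (fun i : ℕ => B / (4 * (i : ℝ) ^ α)) p) : Tendsto p atTop (𝓝 0) :=
  (((tendsto_natCast_rpow_atTop hα0).const_mul_atTop four_pos).const_div_atTop B).congr'
    (htr.eventually_eq.mono fun _ h => h.symm)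

lemma eventually_ascentProb_le (hp : ∀ i, 1 ≤ i → 0 ≤ p i ∧ p i < 1 / 2)
    (h0 : Tendsto p atTop (𝓝 0)) {c : ℝ} (hc : 1 / 2 < c) :
    ∀ᶠ R in atTop, ∀ S, R ≤ S → ∀ j, ascentProb p S j ≤ c ^ j := by
  have h1 : ∀ᶠ i in atTop, p i ≤ c - 1 / 2 := h0.eventually_le_const (by linarith)
  filter_upwards [eventually_forall_ge_atTop.2 h1, eventually_ge_atTop 1] with R hR hR1 S hS j
  rw [ascentProb, ← Finset.card_range j, ← Finset.prod_const, Finset.card_range]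
  refine Finset.prod_le_prod (fun i _ => E_nonneg hp _) fun i _ => ?_
  rw [E, if_neg (by omega)]
  linarith [hR (S + i) (by omega)]

lemma half_pow_le_ascentProb (hp : ∀ i, 1 ≤ i → 0 ≤ p i ∧ p i < 1 / 2) (R j : ℕ) :
    (1 / 2 : ℝ) ^ j ≤ ascentProb p R j := by
  rw [ascentProb, ← Finset.card_range j, ← Finset.prod_const, Finset.card_range]
  exact Finset.prod_le_prod (fun i _ => by norm_num) fun i _ => half_le_E hp _

lemma eventually_rpow_succ_le {c : ℝ} (hc : 0 < c) (hα0 : 0 < α) (hα1 : α < 1) :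
    ∀ᶠ m : ℕ in atTop, ((m + 1 : ℕ) : ℝ) ^ α ≤ (m : ℝ) ^ α + c := by
  have h1 : Tendsto (fun m : ℕ => α * (m : ℝ) ^ (-(1 - α))) atTop (𝓝 (α * 0)) :=
    ((tendsto_rpow_neg_atTop (by linarith)).comp tendsto_natCast_atTop_atTop).const_mul α
  rw [mul_zero] at h1
  filter_upwards [h1.eventually_le_const hc, eventually_ge_atTop 1] with m hm hm1
  have hm0 : (0 : ℝ) < m := by exact_mod_cast hm1
  have h2 : ((m + 1 : ℕ) : ℝ) = m * (1 + 1 / m) := by push_cast; field_simp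
  have h3 : (0 : ℝ) ≤ 1 / m := by positivity
  have h4 := rpow_one_add_le_one_add_mul_self (s := 1 / (m : ℝ)) (by linarith) hα0.le hα1.le
  have h5 : (m : ℝ) ^ (-(1 - α)) = (m : ℝ) ^ α * (1 / m) := by
    rw [neg_sub, Real.rpow_sub_one hm0.ne']
    ring
  rw [h5] at hm
  rw [h2, Real.mul_rpow hm0.le (by linarith)]
  have h6 := mul_le_mul_of_nonneg_left h4 (Real.rpow_nonneg hm0.le α)
  linarith

lemma exists_scale_le (hB : 0 < B) (hα0 : 0 < α) (hα1 : α < 1)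
    (hp : ∀ i, 1 ≤ i → 0 ≤ p i ∧ p i < 1 / 2)
    (htr : IsTruncation (fun i : ℕ => B / (4 * (i : ℝ) ^ α)) p) :
    ∃ m₀ : ℕ, ∀ m, m₀ ≤ m → ∀ k, scale p m k ≤ 4 / B * (m : ℝ) ^ α := by
  have key : ∀ᶠ m : ℕ in atTop,
      1 + U p (m + 1) * (4 / B * ((m + 1 : ℕ) : ℝ) ^ α) ≤ 4 / B * (m : ℝ) ^ α := by
    filter_upwards [eventually_rpow_succ_le (c := B / 4) (by positivity) hα0 hα1,
      (tendsto_add_atTop_nat 1).eventually htr.eventually_eq] with m h1 h2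
    have h3 := hp (m + 1) (by omega)
    have h4 : U p (m + 1) ≤ 1 - 2 * p (m + 1) := by
      rw [U, div_le_iff₀ (by linarith)]
      nlinarith
    set x := ((m + 1 : ℕ) : ℝ) ^ α
    have hx : 0 < x := Real.rpow_pos_of_pos (by positivity) α
    have h5 : U p (m + 1) * (4 / B * x) ≤ 4 / B * x - 2 := by
      refine (mul_le_mul_of_nonneg_right h4 (by positivity)).trans (le_of_eq ?_)
      rw [h2]
      field_simp
    have h6 : 4 / B * x ≤ 4 / B * (m : ℝ) ^ α + 1 := by
      refine (mul_le_mul_of_nonneg_left h1 (by positivity)).trans (le_of_eq ?_)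
      field_simp
    linarith
  obtain ⟨m₀, hm₀⟩ := eventually_atTop.1 key
  exact ⟨m₀, fun m hm k => scale_le_of_supersolution hp (h := fun m => 4 / B * (m : ℝ) ^ α)
    (fun m => by positivity) hm₀ k m hm⟩

lemma eventually_exists_le_scale (hB : 0 < B) (hα0 : 0 < α)
    (hp : ∀ i, 1 ≤ i → 0 ≤ p i ∧ p i < 1 / 2)
    (htr : IsTruncation (fun i : ℕ => B / (4 * (i : ℝ) ^ α)) p) :
    ∀ᶠ m : ℕ in atTop, ∃ k, 1 ≤ k ∧ (m : ℝ) ^ α / (8 * B) ≤ scale p m k := by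
  filter_upwards [htr.eventually_eq, eventually_ge_atTop 1,
    (tendsto_natCast_rpow_atTop hα0).eventually_ge_atTop (4 * B)] with m h1 hm h2
  set x := (m : ℝ) ^ α
  have hx : 0 < x := by linarith
  have hanti := htr.succ_le hB hα0
  set k := ⌊x / (2 * B)⌋₊
  have hk1 : (k : ℝ) ≤ x / (2 * B) := Nat.floor_le (by positivity)
  have hk2 : x / (2 * B) < k + 1 := Nat.lt_floor_add_one _
  have h3 : 1 ≤ x / (4 * B) := by rwa [one_le_div (by positivity)]
  have h4 : x / (2 * B) = 2 * (x / (4 * B)) := by field_simp; norm_num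
  have h8 : x / (8 * B) = x / (4 * B) / 2 := by field_simp; norm_num
  have hk3 : x / (4 * B) < k := by linarith
  have hk : 1 ≤ k := by
    have : (0 : ℝ) < k := by linarith
    exact_mod_cast this
  refine ⟨k, hk, le_trans ?_ (mul_oddsProd_le_scale hp m k)⟩
  have h5 := one_sub_le_oddsProd hp hanti m k
  have h6 : p (m + 1) ≤ B / (4 * x) := h1 ▸ hanti m hm
  have h7 : 4 * p (m + 1) * k ≤ 1 / 2 := by
    calc 4 * p (m + 1) * k ≤ 4 * (B / (4 * x)) * (x / (2 * B)) := by gcongr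
      _ = 1 / 2 := by field_simp
  rw [h8]
  have h11 : (1 / 2 : ℝ) ≤ oddsProd p m k := by linarith
  nlinarith

end Asymptotics

section RunLength

variable {B α : ℝ} {p : ℕ → ℝ}

lemma fStar_nonneg {ε : ℝ} (hα1 : α < 1) (hε : 0 ≤ ε) (R : ℕ) : 0 ≤ fStar α R ε := by
  have h1 := Real.log_natCast_nonneg R
  have h2 := Real.log_pos one_lt_two
  have h3 : 0 < 1 - α := by linarith
  unfold fStar
  positivity

lemma two_rpow_neg_mul_fStar {R : ℕ} (hR : 1 ≤ R) (s ε : ℝ) :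
    (2 : ℝ) ^ (-(s * fStar α R ε)) = (R : ℝ) ^ (-(s * (1 + ε) * (1 - α))) := by
  have h2 := Real.log_pos one_lt_two
  rw [Real.rpow_def_of_pos two_pos, Real.rpow_def_of_pos (by exact_mod_cast hR), fStar]
  congr 1
  field_simp

lemma two_rpow_neg_pow_le {R : ℕ} (hR : 1 ≤ R) {s : ℝ} (hs : 0 ≤ s) (ε : ℝ) :
    ((2 : ℝ) ^ (-s)) ^ (⌊fStar α R ε⌋₊ + 1) ≤ (R : ℝ) ^ (-(s * (1 + ε) * (1 - α))) := by
  rw [← two_rpow_neg_mul_fStar hR, ← Real.rpow_natCast, ← Real.rpow_mul two_pos.le]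
  refine Real.rpow_le_rpow_of_exponent_le one_le_two ?_
  have := (Nat.lt_floor_add_one (fStar α R ε)).le
  push_cast
  nlinarith

lemma rpow_le_half_pow_floor {R : ℕ} (hR : 1 ≤ R) (hα1 : α < 1) :
    (R : ℝ) ^ (-(1 - α)) ≤ (1 / 2 : ℝ) ^ ⌊fStar α R 0⌋₊ := by
  have h := two_rpow_neg_mul_fStar (α := α) hR 1 0
  have h1 := Nat.floor_le (fStar_nonneg hα1 le_rfl R)
  rw [one_mul, one_mul, add_zero, one_mul] at h
  rw [← h, one_div, inv_pow, ← Real.rpow_natCast, ← Real.rpow_neg two_pos.le]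
  exact Real.rpow_le_rpow_of_exponent_le one_le_two (by linarith)

lemma floor_fStar_le {R : ℕ} (hα0 : 0 < α) : ⌊fStar α R 0⌋₊ ≤ R := by
  have h2 := Real.log_pos one_lt_two
  refine Nat.floor_le_of_le ?_
  rw [fStar, div_le_iff₀ h2]
  rcases Nat.eq_zero_or_pos R with rfl | hR
  · simp
  have h3 : Real.log R ≤ R * Real.log 2 := by
    rw [← Real.log_pow]
    exact Real.log_le_log (by exact_mod_cast hR) (by exact_mod_cast Nat.lt_two_pow_self.le)
  have h4 := Real.log_natCast_nonneg R
  nlinarith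

lemma floor_fStar_mono (hα1 : α < 1) {R S : ℕ} (hR : 1 ≤ R) (h : R ≤ S) :
    ⌊fStar α R 0⌋₊ ≤ ⌊fStar α S 0⌋₊ := by
  have h2 := Real.log_pos one_lt_two
  have h3 : 0 ≤ 1 - α := by linarith
  refine Nat.floor_mono ?_
  unfold fStar
  have : Real.log R ≤ Real.log S :=
    Real.log_le_log (by exact_mod_cast hR) (by exact_mod_cast h)
  gcongr

lemma half_lt_two_rpow_neg {s : ℝ} (hs : s < 1) : (1 / 2 : ℝ) < 2 ^ (-s) := by
  have : (1 / 2 : ℝ) = 2 ^ (-1 : ℝ) := by rw [Real.rpow_neg_one]; norm_num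
  rw [this]
  exact Real.rpow_lt_rpow_of_exponent_lt one_lt_two (by linarith)

lemma sum_Ico_comp_sub_le {φ : ℕ → ℝ} (hφ : ∀ k, 0 ≤ φ k) (hφ0 : φ 0 = 0) (hs : Summable φ)
    (m a n : ℕ) : ∑ S ∈ Finset.Ico a n, φ (S - m) ≤ ∑' k, φ k := by
  have hsub : Finset.Ico a n ⊆ Finset.range (m + n) := fun S hS => by
    have := (Finset.mem_Ico.1 hS).2
    exact Finset.mem_range.2 (by omega)
  refine (Finset.sum_le_sum_of_subset_of_nonneg hsub fun _ _ _ => hφ _).trans ?_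
  rw [Finset.sum_range_add, Finset.sum_eq_zero fun S hS => by
    rw [Nat.sub_eq_zero_of_le (Finset.mem_range.1 hS).le, hφ0], zero_add]
  simp only [Nat.add_sub_cancel_left]
  exact hs.sum_le_tsum _ fun k _ => hφ k

end RunLength

namespace IsPathFamily

variable {B α : ℝ} {p : ℕ → ℝ} {μ : ℕ → Measure (ℕ → ℕ)}

/-- Runs of once-visited sites longer than `f*(R,ε)` occur only finitely often. -/
lemma ae_eventually_exists_visits_gt (hμ : IsPathFamily p μ) (hB : 0 < B) (hα0 : 0 < α)
    (hα1 : α < 1) (hp : ∀ i, 1 ≤ i → 0 ≤ p i ∧ p i < 1 / 2)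
    (htr : IsTruncation (fun i : ℕ => B / (4 * (i : ℝ) ^ α)) p) {ε : ℝ} (hε : 0 < ε) :
    ∀ᵐ w ∂μ 0, ∀ᶠ R : ℕ in atTop,
      ∃ S : ℕ, R ≤ S ∧ (S : ℝ) ≤ (R : ℝ) + fStar α R ε ∧ 1 < visits S w := by
  have := hμ.prob
  set s : ℝ := (1 + ε / 2) / (1 + ε)
  have hs1 : s < 1 := by rw [div_lt_one (by linarith)]; linarith
  have hs0 : 0 ≤ s := by positivity
  have hsε : s * (1 + ε) = 1 + ε / 2 := by
    simp only [s]
    field_simp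
  set A : ℕ → Set (ℕ → ℕ) := fun R => atMostOnce R (⌊fStar α R ε⌋₊ + 1)
  have hbound : ∀ᶠ R : ℕ in atTop,
      (μ 0).real (A R) ≤ 8 * B * (R : ℝ) ^ (-(1 + ε / 2 * (1 - α))) := by
    filter_upwards [eventually_forall_ge_atTop.2 (eventually_exists_le_scale hB hα0 hp htr),
      eventually_ascentProb_le hp (htr.tendsto_zero hα0) (half_lt_two_rpow_neg hs1),
      eventually_ge_atTop 1] with R h1 h2 hR
    obtain ⟨k, hk, h3⟩ := h1 (R + ⌊fStar α R ε⌋₊) (by omega)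
    have hR0 : (0 : ℝ) < R := by exact_mod_cast hR
    have h4 := hμ.real_atMostOnce_mul_scale_le hp (j := ⌊fStar α R ε⌋₊) hR hk
    have h5 := h4.trans ((h2 R le_rfl _).trans (two_rpow_neg_pow_le hR hs0 ε))
    rw [hsε] at h5
    have h6 : (R : ℝ) ^ α / (8 * B) ≤ scale p (R + ⌊fStar α R ε⌋₊) k := by
      refine le_trans ?_ h3
      have : (R : ℝ) ^ α ≤ ((R + ⌊fStar α R ε⌋₊ : ℕ) : ℝ) ^ α :=
        Real.rpow_le_rpow hR0.le (by push_cast; linarith [Nat.cast_nonneg (α := ℝ) ⌊fStar α R ε⌋₊])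
          hα0.le
      gcongr
    have h7 := (mul_le_mul_of_nonneg_left h6 (measureReal_nonneg (μ := μ 0) (s := A R))).trans h5
    have hx : 0 < (R : ℝ) ^ α := Real.rpow_pos_of_pos hR0 α
    rw [← le_div_iff₀ (by positivity)] at h7
    refine h7.trans (le_of_eq ?_)
    rw [show -(1 + ε / 2 * (1 - α)) = -((1 + ε / 2) * (1 - α)) - α by ring, Real.rpow_sub hR0]
    field_simp
  have hsum : Summable fun R => (μ 0).real (A R) := by
    refine Summable.of_norm_bounded_eventually_nat
      (g := fun R : ℕ => 8 * B * (R : ℝ) ^ (-(1 + ε / 2 * (1 - α)))) ?_ ?_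
    · refine Summable.mul_left _ (Real.summable_nat_rpow.2 ?_)
      have : 0 < ε / 2 * (1 - α) := mul_pos (by linarith) (by linarith)
      linarith
    · filter_upwards [hbound] with R hR
      rwa [Real.norm_of_nonneg measureReal_nonneg]
  have hfin : ∑' R, μ 0 (A R) ≠ ∞ := by
    have h := hsum.tsum_ofReal_ne_top
    simpa [ofReal_measureReal] using h
  filter_upwards [ae_eventually_notMem hfin] with w hw
  filter_upwards [hw] with R hR
  simp only [A, atMostOnce, Set.mem_ofPred_eq, not_forall, not_le] at hR
  obtain ⟨i, hi, hlt⟩ := hR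
  refine ⟨R + i, by omega, ?_, hlt⟩
  have h1 : (i : ℝ) ≤ ⌊fStar α R ε⌋₊ := by exact_mod_cast Nat.lt_succ_iff.1 hi
  have h2 := Nat.floor_le (fStar_nonneg hα1 hε.le R)
  push_cast
  linarith

/-- Runs of once-visited sites of length `g*(R)` occur infinitely often. -/
lemma ae_frequently_atMostOnce (hμ : IsPathFamily p μ) (hB : 0 < B) (hα0 : 0 < α)
    (hα1 : α < 1) (hp : ∀ i, 1 ≤ i → 0 ≤ p i ∧ p i < 1 / 2)
    (htr : IsTruncation (fun i : ℕ => B / (4 * (i : ℝ) ^ α)) p) :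
    ∀ᵐ w ∂μ 0, ∃ᶠ R : ℕ in atTop, w ∈ atMostOnce R (⌊fStar α R 0⌋₊ + 1) := by
  have := hμ.prob
  have hanti := htr.succ_le hB hα0
  set g : ℕ → ℕ := fun R => ⌊fStar α R 0⌋₊
  set r : ℝ := 2 ^ (-(1 / 2) : ℝ)
  have hr0 : 0 ≤ r := by positivity
  have hr1 : r < 1 := Real.rpow_lt_one_of_one_lt_of_neg one_lt_two (by norm_num)
  set δ : ℝ := (1 - α) / 2 with hδ
  have hδ0 : 0 < δ := by rw [hδ]; linarith
  obtain ⟨m₀, hscale⟩ := exists_scale_le hB hα0 hα1 hp htr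
  obtain ⟨m₁, hasc⟩ := eventually_atTop.1
    (eventually_ascentProb_le hp (htr.tendsto_zero hα0) (half_lt_two_rpow_neg one_half_lt_one))
  have hsummable : ∀ m, m₀ ≤ m → Summable (oddsProd p m) := fun m hm =>
    summable_of_sum_range_le (fun j => (oddsProd_pos hp m j).le) (hscale m hm)
  set φ₁ : ℕ → ℝ := fun k => k * r ^ k
  set φ₂ : ℕ → ℝ := fun k => (k : ℝ) ^ (-(1 + δ))
  have hφ₁ : Summable φ₁ := by
    simpa using summable_pow_mul_geometric_of_norm_lt_one 1
      (by rwa [Real.norm_of_nonneg hr0] : ‖r‖ < 1)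
  have hφ₂ : Summable φ₂ := Real.summable_nat_rpow.2 (by linarith)
  have hφ₁0 : ∀ k, 0 ≤ φ₁ k := fun k => by positivity
  have hφ₂0 : ∀ k, 0 ≤ φ₂ k := fun k => by positivity
  refine ae_frequently_mem_of_sum_inter_le (C := ∑' k, φ₁ k + ∑' k, φ₂ k)
    (R₀ := m₀ + m₁ + 1) (fun R => measurableSet_atMostOnce R (g R + 1)) ?_ ?_
  · intro R hR n
    have hpair : ∀ S ∈ Finset.Ico (R + 1) n,
        (μ 0).real (atMostOnce R (g R + 1) ∩ atMostOnce S (g S + 1)) ≤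
          (μ 0).real (atMostOnce R (g R + 1)) *
            (φ₁ (S - R) + φ₂ (S - (R + g R)) + (μ 0).real (atMostOnce S (g S + 1))) := by
      intro S hS
      have hRS := (Finset.mem_Ico.1 hS).1
      have hS0 := measureReal_nonneg (μ := μ 0) (s := atMostOnce S (g S + 1))
      have hs : ∀ m, R ≤ m → Summable (oddsProd p m) := fun m hm => hsummable m (by omega)
      rcases Nat.lt_or_ge (R + g R) S with hlt | hle
      · obtain ⟨k, rfl⟩ : ∃ k, S = R + g R + k := ⟨S - (R + g R), by omega⟩
        have hk : 1 ≤ k := by omega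
        have hk0 : (0 : ℝ) < k := by exact_mod_cast hk
        refine (hμ.real_inter_le_of_separated hp hanti (by omega) hk hs).trans
          (mul_le_mul_of_nonneg_left ?_ measureReal_nonneg)
        rw [Nat.add_sub_cancel_left]
        have h1 := (hasc (R + g R + k) (by omega) (R + g R + k) le_rfl
          (g (R + g R + k) + 1)).trans
          (two_rpow_neg_pow_le (α := α) (by omega) one_half_pos.le 0)
        have h2 : ((R + g R + k : ℕ) : ℝ) ^ (-(1 / 2 * (1 + 0) * (1 - α))) ≤
            (k : ℝ) ^ (-δ) := by
          rw [show -(1 / 2 * (1 + 0) * (1 - α)) = -δ by rw [hδ]; ring]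
          exact Real.rpow_le_rpow_of_nonpos hk0 (by exact_mod_cast Nat.le_add_left k _)
            (by linarith)
        have h3 : φ₂ k = (k : ℝ) ^ (-δ) / k := by
          simp only [φ₂]
          rw [neg_add', sub_eq_add_neg, add_comm, ← sub_eq_add_neg,
            ← Real.rpow_sub_one hk0.ne']
        have h4 : ascentProb p (R + g R + k) (g (R + g R + k) + 1) / k ≤ φ₂ k := by
          rw [h3]
          gcongr
          exact h1.trans h2
        linarith [hφ₁0 (R + g R + k - R)]
      · obtain ⟨i, rfl⟩ : ∃ i, S = R + i := ⟨S - R, by omega⟩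
        have hi : (1 : ℝ) ≤ i := by exact_mod_cast (by omega : 1 ≤ i)
        refine (hμ.real_inter_le_of_overlap hp hanti (by omega) (j := g R) (by omega)
          (floor_fStar_mono hα1 (by omega) (by omega)) hr1.le
          (fun S l hS => hasc R (by omega) S hS l) hs).trans
          (mul_le_mul_of_nonneg_left ?_ measureReal_nonneg)
        rw [Nat.add_sub_cancel_left]
        have h1 : r ^ i ≤ φ₁ i := le_mul_of_one_le_left (by positivity) hi
        linarith [hφ₂0 (R + i - (R + g R))]
    refine (Finset.sum_le_sum hpair).trans ?_
    rw [← Finset.mul_sum, Finset.sum_add_distrib, Finset.sum_add_distrib]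
    refine mul_le_mul_of_nonneg_left ?_ measureReal_nonneg
    have h1 := sum_Ico_comp_sub_le hφ₁0 (by simp [φ₁]) hφ₁ R (R + 1) n
    have h2 := sum_Ico_comp_sub_le hφ₂0
      (by simp only [φ₂]; rw [Nat.cast_zero, Real.zero_rpow (by linarith)]) hφ₂ (R + g R) (R + 1) n
    linarith
  · intro hsum
    refine Real.not_summable_natCast_inv ?_
    refine Summable.of_norm_bounded_eventually_nat
      (g := fun R => 16 / B * (μ 0).real (atMostOnce R (g R + 1))) (hsum.mul_left _) ?_
    filter_upwards [eventually_ge_atTop m₀, eventually_ge_atTop 1] with R hR hR1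
    have hR0 : (0 : ℝ) < R := by exact_mod_cast hR1
    have h1 := hμ.ascentProb_le_mul_real_atMostOnce hp (R := R) (j := g R)
      (hscale (R + g R) (by omega))
    have h2 : ((R + g R : ℕ) : ℝ) ^ α ≤ 2 * (R : ℝ) ^ α := by
      have h3 : (2 : ℝ) ^ α ≤ 2 := by
        simpa using Real.rpow_le_rpow_of_exponent_le one_le_two hα1.le
      have h4 : ((R + g R : ℕ) : ℝ) ≤ 2 * R := by
        have : (g R : ℝ) ≤ R := by exact_mod_cast floor_fStar_le hα0
        push_cast
        linarith
      calc ((R + g R : ℕ) : ℝ) ^ α ≤ (2 * R : ℝ) ^ α :=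
            Real.rpow_le_rpow (Nat.cast_nonneg _) h4 hα0.le
        _ = 2 ^ α * (R : ℝ) ^ α := Real.mul_rpow two_pos.le hR0.le
        _ ≤ _ := by gcongr
    have h5 : (R : ℝ) ^ (-(1 - α)) * (1 / 2) ≤ ascentProb p R (g R + 1) := by
      refine le_trans ?_ (half_pow_le_ascentProb hp R (g R + 1))
      rw [pow_succ]
      exact mul_le_mul_of_nonneg_right (rpow_le_half_pow_floor hR1 hα1) (by norm_num)
    have hx : 0 < (R : ℝ) ^ α := Real.rpow_pos_of_pos hR0 α
    set a := (μ 0).real (atMostOnce R (g R + 1))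
    have ha : 0 ≤ a := measureReal_nonneg
    have h6 : (R : ℝ) ^ (-(1 - α)) = (R : ℝ) ^ α * (R : ℝ)⁻¹ := by
      rw [neg_sub, Real.rpow_sub_one hR0.ne', div_eq_mul_inv]
    rw [h6] at h5
    have h7 : (R : ℝ) ^ α * (R : ℝ)⁻¹ ≤ (R : ℝ) ^ α * (16 / B * a) := by
      have h8 : 4 / B * ((R + g R : ℕ) : ℝ) ^ α * a ≤ 4 / B * (2 * (R : ℝ) ^ α) * a := by gcongr
      have h9 : 4 / B * (2 * (R : ℝ) ^ α) * a = (R : ℝ) ^ α * (16 / B * a) * (1 / 2) := by ring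
      linarith
    rw [Real.norm_of_nonneg (by positivity)]
    exact le_of_mul_le_mul_left h7 hx

end IsPathFamily

lemma visits_eq_one {S : ℕ} {w : ℕ → ℕ} (h0 : visits S w ≠ 0) (h1 : visits S w ≤ 1) :
    visits S w = 1 := by
  refine le_antisymm h1 ?_
  obtain ⟨k, hk⟩ : ∃ k, w k = S := by
    by_contra! h
    exact h0 (by simp [visits, localTime, h])
  exact le_trans (by simp [hk]) (ENNReal.le_tsum (f := fun k : ℕ =>
    Set.indicator {k | w k = S} (fun _ => (1 : ℝ≥0∞)) k) k)

end NNRW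

/-- for `p_R = B/(4R^α)` (truncation convention), `B > 0`, `0 < α < 1`:
(i) a.s. there are infinitely many `R` with `ξ(R+j,∞) = 1` for all `0 ≤ j ≤ ⌊g*(R)⌋`;
(ii) for every `ε > 0`, a.s. for all large `R` there is `S` with `R ≤ S ≤ R + f*(R,ε)`
and `ξ(S,∞) > 1`. -/
theorem stmt19 (B α : ℝ) (hB : 0 < B) (hα0 : 0 < α) (hα1 : α < 1) (p : ℕ → ℝ)
    (hp : ∀ i, 1 ≤ i → 0 ≤ p i ∧ p i < 1 / 2)
    (htr : IsTruncation (fun i : ℕ => B / (4 * (i : ℝ) ^ α)) p)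
    (Ω : Type) [MeasurableSpace Ω] (P : Measure Ω) [IsProbabilityMeasure P]
    (X : ℕ → Ω → ℕ) (hX : IsNNWalk P X p 0) :
    (∀ᵐ ω ∂P, ∃ᶠ R : ℕ in atTop,
        ∀ j : ℕ, j ≤ ⌊fStar α R 0⌋₊ → localTime X (R + j) ω = 1) ∧
      ∀ ε : ℝ, 0 < ε → ∀ᵐ ω ∂P, ∀ᶠ R : ℕ in atTop,
        ∃ S : ℕ, R ≤ S ∧ (S : ℝ) ≤ (R : ℝ) + fStar α R ε ∧ 1 < localTime X S ω := by
  obtain ⟨μ, hμ, hlaw⟩ := exists_isPathFamily hp hX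
  have := hμ.prob
  have hmeas : AEMeasurable (fun ω n => X n ω) P :=
    aemeasurable_pi_lambda _ fun n => aemeasurable_coord hp hX n
  constructor
  · have hvisit : ∀ᵐ w ∂μ 0, ∀ S, visits S w ≠ 0 := by
      rw [ae_all_iff]
      intro S
      rw [ae_iff]
      have := hμ.real_never_eq_zero hp (x := 0) (S := S) (Nat.zero_le S)
      rw [measureReal_eq_zero_iff] at this
      simpa [never] using this
    have h := hvisit.and (hμ.ae_frequently_atMostOnce hB hα0 hα1 hp htr)
    rw [hlaw] at h
    filter_upwards [ae_of_ae_map hmeas h] with ω hω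
    refine hω.2.mono fun R hR j hj => visits_eq_one (hω.1 (R + j)) (hR j (by omega))
  · intro ε hε
    have h := hμ.ae_eventually_exists_visits_gt hB hα0 hα1 hp htr hε
    rw [hlaw] at h
    exact ae_of_ae_map hmeas h
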